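/- arXiv:0901.0253 — 3 statements merged into one kernel-verified Lean document; each statement's English description precedes it below -/
import Mathlib

section
/- Let A be an essential central arrangement of d hyperplanes of rank n over K = ℂ, with Orlik–Terao ideal I ⊆ R = K[y_1,…,y_d] and quadratic component I_2 (the ideal generated by the degree-2 elements of I). Then A is 2-formal if and only if the set X = V(I_2) ∩ (K^*)^d, consisting of the points of the affine variety V(I_2) ⊆ K^d all of whose coordinates are nonzero, has codimension d − n in K^d (equivalently, dimension n). -/
open MvPolynomial

/-- An essential central arrangement of hyperplanes in `K^n`, with hyperplanes indexed by `ι`: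
the hyperplane `H i` is the kernel of the nonzero linear form with coefficient vector `form i`,
the forms are pairwise non-proportional (the hyperplanes are distinct), and they span the dual
space (the arrangement is essential, i.e. has rank `n`). -/
structure CentralArrangement (K : Type*) [Field K] (ι : Type*) [Fintype ι] (n : ℕ) where
  form : ι → (Fin n → K)
  nonzero : ∀ i, form i ≠ 0
  nonProportional : ∀ i j, i ≠ j → ∀ t : K, form i ≠ t • form j
  essential : Submodule.span K (Set.range form) = ⊤

namespace CentralArrangement

variable {K : Type*} [Field K] {ι : Type*} [Fintype ι] {n : ℕ}

/-- The evaluation map `K^ι → K[x_1,…,x_n]_1 ≅ K^n`, sending `e i` to the form `α i`. -/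
noncomputable def evalMap (A : CentralArrangement K ι n) : (ι → K) →ₗ[K] (Fin n → K) where
  toFun c := ∑ i, c i • A.form i
  map_add' x y := by
    simp [add_smul, Finset.sum_add_distrib]
  map_smul' t x := by
    simp [smul_smul, Finset.smul_sum]

/-- The relation space `F(A)`: the kernel of the evaluation map. -/
noncomputable def relSpace (A : CentralArrangement K ι n) : Submodule K (ι → K) :=
  LinearMap.ker A.evalMap

end CentralArrangement

open Classical in
/-- The support of a vector `c : ι → K`, as a finset. -/
noncomputable def vsupp {K ι : Type*} [Field K] [Fintype ι] (c : ι → K) : Finset ι :=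
  Finset.univ.filter fun j => c j ≠ 0

/-- The Orlik-Terao boundary `∂(c) = Σ_{j ∈ Λ} c_j · Π_{l ∈ Λ, l ≠ j} y_l`, where
`Λ` is the support of the dependency `c`. -/
noncomputable def otgen {K ι : Type*} [Field K] [Fintype ι] [DecidableEq ι] (c : ι → K) :
    MvPolynomial ι K :=
  ∑ j ∈ vsupp c, MvPolynomial.C (c j) * ∏ l ∈ (vsupp c).erase j, MvPolynomial.X l

namespace CentralArrangement

variable {K : Type*} [Field K] {ι : Type*} [Fintype ι] [DecidableEq ι] {n : ℕ}

/-- The Orlik-Terao ideal `I`, generated by `∂(c)` for all relations `c ∈ F(A)`. -/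
noncomputable def otIdeal (A : CentralArrangement K ι n) : Ideal (MvPolynomial ι K) :=
  Ideal.span (otgen '' (A.relSpace : Set (ι → K)))

/-- The quadratic component `I₂` of the Orlik-Terao ideal: the ideal generated by the
degree-2 (homogeneous) elements of `I`. -/
noncomputable def otQuadratic (A : CentralArrangement K ι n) : Ideal (MvPolynomial ι K) :=
  Ideal.span {f | f ∈ A.otIdeal ∧ f.IsHomogeneous 2}

/-- A 3-relation is an element of `F(A)` with support of size 3; the arrangement is
2-formal if the 3-relations span the relation space. -/
def IsTwoFormal (A : CentralArrangement K ι n) : Prop :=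
  Submodule.span K {c : ι → K | c ∈ A.relSpace ∧ (vsupp c).card = 3} = A.relSpace

end CentralArrangement

open MvPolynomial in
/-- The affine zero locus `V(I) ⊆ K^ι` of an ideal of polynomials. -/
def affineZeroLocus {K ι : Type*} [CommSemiring K] (I : Ideal (MvPolynomial ι K)) :
    Set (ι → K) :=
  {p | ∀ f ∈ I, eval p f = 0}

open MvPolynomial in
/-- The vanishing ideal `I(X)` of a subset `X ⊆ K^ι`. -/
def affineVanishingIdeal (K ι : Type*) [CommRing K] (X : Set (ι → K)) :
    Ideal (MvPolynomial ι K) where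
  carrier := {f | ∀ p ∈ X, eval p f = 0}
  add_mem' := by
    intro f g hf hg p hp
    simp [hf p hp, hg p hp]
  zero_mem' := by
    intro p hp
    simp
  smul_mem' := by
    intro c f hf p hp
    simp [smul_eq_mul, hf p hp]

section KrullDimension

/-- An integral extension of commutative rings has the same Krull dimension as the base. -/
theorem ringKrullDim_eq_of_isIntegral {R S : Type*} [CommRing R] [CommRing S] [Algebra R S]
    [Algebra.IsIntegral R S] [FaithfulSMul R S] : ringKrullDim S = ringKrullDim R := by
  apply le_antisymm
  · refine Order.krullDim_le_of_strictMono (PrimeSpectrum.comap (algebraMap R S)) ?_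
    intro P Q h
    exact Ideal.IsIntegral.comap_lt_comap (I := P.asIdeal) (J := Q.asIdeal) h
  · refine iSup_le fun l => ?_
    obtain ⟨P, hP, hPl⟩ :=
      (Ideal.nonempty_primesOver (R := R) (S := S) (RelSeries.head l).asIdeal).some
    have := hP
    have := hPl
    have : Algebra.HasGoingUp R S := Algebra.HasGoingUp.of_isIntegral
    obtain ⟨L, hL, -⟩ := Ideal.exists_ltSeries_of_hasGoingUp (S := S) l P
    rw [← hL]
    exact le_iSup (fun l : LTSeries (PrimeSpectrum S) => (l.length : WithBot ℕ∞)) L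

/-- The Krull dimension of a finitely generated domain over a field is its transcendence
degree. -/
theorem ringKrullDim_eq_of_trdeg_eq {k S : Type*} [Field k] [CommRing S] [IsDomain S]
    [Algebra k S] [Algebra.FiniteType k S] {m : ℕ} (h : Algebra.trdeg k S = m) :
    ringKrullDim S = m := by
  obtain ⟨s, g, hg, hint⟩ := exists_integral_inj_algHom_of_fg k S
  algebraize [g.toRingHom]
  have : IsScalarTower k (MvPolynomial (Fin s) k) S := .of_algebraMap_eq fun x => (g.commutes x).symm
  have : FaithfulSMul (MvPolynomial (Fin s) k) S := (faithfulSMul_iff_algebraMap_injective _ _).2 hg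
  have : Algebra.IsIntegral (MvPolynomial (Fin s) k) S := ⟨hint⟩
  have htr := lift_trdeg_add_eq k (MvPolynomial (Fin s) k) S
  rw [trdeg_eq_zero (R := MvPolynomial (Fin s) k), MvPolynomial.trdeg_of_isDomain, h] at htr
  have hs : s = m := by simpa using htr
  rw [ringKrullDim_eq_of_isIntegral (R := MvPolynomial (Fin s) k),
    MvPolynomial.ringKrullDim_of_isNoetherianRing, ringKrullDim_eq_zero_of_field, hs]
  simp

end KrullDimension

section InverseParametrization

variable {K ι σ : Type*} [Field K]

/-- The algebra map sending `y i` to the inverse of `ℓ i` in the field of rational functions. -/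
noncomputable def inverseHom (ℓ : ι → MvPolynomial σ K) :
    MvPolynomial ι K →ₐ[K] FractionRing (MvPolynomial σ K) :=
  aeval fun i => (algebraMap _ (FractionRing (MvPolynomial σ K)) (ℓ i))⁻¹

/-- The set of points with coordinates inverse to the values of the polynomials `ℓ i`. -/
def inverseImage (ℓ : ι → MvPolynomial σ K) : Set (ι → K) :=
  {p | ∃ w, (∀ i, eval w (ℓ i) ≠ 0) ∧ p = fun i => (eval w (ℓ i))⁻¹}

theorem exists_inverseHom_numerator [Fintype ι] (ℓ : ι → MvPolynomial σ K) (hℓ : ∀ i, ℓ i ≠ 0)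
    (f : MvPolynomial ι K) :
    ∃ (N : ℕ) (g : MvPolynomial σ K),
      algebraMap _ (FractionRing (MvPolynomial σ K)) g =
        algebraMap _ _ (∏ i, ℓ i) ^ N * inverseHom ℓ f ∧
      ∀ w, (∀ i, eval w (ℓ i) ≠ 0) →
        eval w g = eval w (∏ i, ℓ i) ^ N * eval (fun i => (eval w (ℓ i))⁻¹) f := by
  classical
  induction f using MvPolynomial.induction_on with
  | C a =>
    refine ⟨0, C a, ?_, fun w _ => by simp⟩
    rw [pow_zero, one_mul, ← MvPolynomial.algebraMap_eq, ← MvPolynomial.algebraMap_eq,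
      AlgHom.commutes, ← IsScalarTower.algebraMap_apply]
  | add p q hp hq =>
    obtain ⟨N, g, hg, hg'⟩ := hp
    obtain ⟨M, h, hh, hh'⟩ := hq
    refine ⟨N + M, (∏ i, ℓ i) ^ M * g + (∏ i, ℓ i) ^ N * h, ?_, fun w hw => ?_⟩
    · simp only [map_add, map_mul, map_pow, hg, hh]
      ring
    · simp only [map_add, map_mul, map_pow, hg' w hw, hh' w hw]
      ring
  | mul_X p i hp =>
    obtain ⟨N, g, hg, hg'⟩ := hp
    have hprod : ∏ j, ℓ j = ℓ i * ∏ j ∈ Finset.univ.erase i, ℓ j :=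
      (Finset.mul_prod_erase _ _ (Finset.mem_univ i)).symm
    refine ⟨N + 1, g * ∏ j ∈ Finset.univ.erase i, ℓ j, ?_, fun w hw => ?_⟩
    · have hi : algebraMap _ (FractionRing (MvPolynomial σ K)) (ℓ i) ≠ 0 := by
        simpa using hℓ i
      have hX : inverseHom ℓ (X i) = (algebraMap _ (FractionRing (MvPolynomial σ K)) (ℓ i))⁻¹ := by
        simp [inverseHom]
      rw [pow_succ, map_mul, map_mul (inverseHom ℓ), hg, hX]
      nth_rw 3 [hprod]
      rw [map_mul]
      field_simp
    · rw [pow_succ, map_mul, map_mul, hg' w hw, eval_X]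
      nth_rw 3 [hprod]
      rw [map_mul]
      have := hw i
      field_simp

theorem affineVanishingIdeal_inverseImage [Fintype ι] [Infinite K] (ℓ : ι → MvPolynomial σ K)
    (hℓ : ∀ i, ℓ i ≠ 0) :
    affineVanishingIdeal K ι (inverseImage ℓ) = RingHom.ker (inverseHom ℓ) := by
  ext f
  obtain ⟨N, g, hg, hg'⟩ := exists_inverseHom_numerator ℓ hℓ f
  have hL : ∏ i, ℓ i ≠ 0 := Finset.prod_ne_zero_iff.2 fun i _ => hℓ i
  have hker : f ∈ RingHom.ker (inverseHom ℓ) ↔ g = 0 := by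
    rw [RingHom.mem_ker, ← (IsFractionRing.injective (MvPolynomial σ K)
      (FractionRing (MvPolynomial σ K))).eq_iff, hg, map_zero]
    simp [Finset.prod_eq_zero_iff, hℓ]
  have hev : ∀ w, eval w (∏ i, ℓ i) ≠ 0 ↔ ∀ i, eval w (ℓ i) ≠ 0 := fun w => by
    simp [map_prod, Finset.prod_eq_zero_iff]
  rw [hker]
  constructor
  · intro hf
    suffices g * ∏ i, ℓ i = 0 from (mul_eq_zero.1 this).resolve_right hL
    refine MvPolynomial.funext fun w => ?_
    rw [map_mul, map_zero]
    by_cases hw : ∀ i, eval w (ℓ i) ≠ 0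
    · rw [hg' w hw, hf _ ⟨w, hw, rfl⟩]
      simp
    · rw [not_ne_iff.1 (mt (hev w).1 hw), mul_zero]
  · rintro rfl p ⟨w, hw, rfl⟩
    have := hg' w hw
    rw [map_zero, eq_comm, mul_eq_zero] at this
    exact this.resolve_left (pow_ne_zero _ ((hev w).2 hw))

theorem trdeg_range_inverseHom (ℓ : ι → MvPolynomial σ K)
    (hspan : Algebra.adjoin K (Set.range ℓ) = ⊤) :
    Algebra.trdeg K (inverseHom ℓ).range = Algebra.trdeg K (MvPolynomial σ K) := by
  set F := FractionRing (MvPolynomial σ K)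
  set S := (inverseHom ℓ).range
  have hpoly : ∀ g : MvPolynomial σ K, IsAlgebraic S (algebraMap _ F g) := by
    have hle : Algebra.adjoin K (Set.range ℓ) ≤
        ((Subalgebra.algebraicClosure S F).restrictScalars K).comap
          (Algebra.algHom K (MvPolynomial σ K) F) := by
      refine Algebra.adjoin_le ?_
      rintro _ ⟨i, rfl⟩
      have hmem : (algebraMap _ F (ℓ i))⁻¹ ∈ S := ⟨X i, by simp [inverseHom, F]⟩
      have halg : IsAlgebraic S (algebraMap _ F (ℓ i))⁻¹ :=
        isAlgebraic_algebraMap (⟨_, hmem⟩ : S)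
      exact IsAlgebraic.inv_iff.1 halg
    intro g
    exact hle (hspan ▸ Algebra.mem_top)
  have : Algebra.IsAlgebraic S F := by
    refine ⟨fun x => ?_⟩
    obtain ⟨a, b, -, rfl⟩ := IsFractionRing.div_surjective (A := MvPolynomial σ K) x
    rw [div_eq_mul_inv]
    exact (hpoly a).mul (hpoly b).inv
  have : FaithfulSMul K S :=
    (faithfulSMul_iff_algebraMap_injective K S).2 (algebraMap K S).injective
  have hS := lift_trdeg_add_eq K S F
  have : Algebra.IsAlgebraic (MvPolynomial σ K) F :=
    IsLocalization.isAlgebraic F (nonZeroDivisors (MvPolynomial σ K))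
  have hP := lift_trdeg_add_eq K (MvPolynomial σ K) F
  rw [trdeg_eq_zero (R := S), Cardinal.lift_zero, add_zero] at hS
  rw [trdeg_eq_zero (R := MvPolynomial σ K), Cardinal.lift_zero, add_zero] at hP
  exact Cardinal.lift_injective (hS.trans hP.symm)

theorem ringKrullDim_quotient_vanishingIdeal_inverseImage [Fintype ι] [Infinite K] [Fintype σ]
    (ℓ : ι → MvPolynomial σ K) (hℓ : ∀ i, ℓ i ≠ 0)
    (hspan : Algebra.adjoin K (Set.range ℓ) = ⊤) :
    ringKrullDim (MvPolynomial ι K ⧸ affineVanishingIdeal K ι (inverseImage ℓ)) =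
      Fintype.card σ := by
  rw [affineVanishingIdeal_inverseImage ℓ hℓ,
    ringKrullDim_eq_of_ringEquiv (Ideal.quotientKerEquivRange (inverseHom ℓ)).toRingEquiv]
  have : Algebra.FiniteType K (inverseHom ℓ).range :=
    Algebra.FiniteType.of_surjective (inverseHom ℓ).rangeRestrict
      (inverseHom ℓ).rangeRestrict_surjective
  refine ringKrullDim_eq_of_trdeg_eq (k := K) ?_
  rw [trdeg_range_inverseHom ℓ hspan, MvPolynomial.trdeg_of_isDomain]
  simp

end InverseParametrization

section LinearParametrization

variable {K ι : Type*} [Field K]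

theorem LinearMap.pi_apply_eq_sum_mul_single {α β : Type*} [Fintype α] [DecidableEq α]
    (L : (α → K) →ₗ[K] (β → K)) (w : α → K) (b : β) :
    L w b = ∑ a, w a * L (Pi.single a 1) b := by
  have hw : w = ∑ a, w a • Pi.single a (1 : K) := by
    ext b
    simp [Pi.single_apply]
  conv_lhs => rw [hw]
  simp

/-- The `i`-th coordinate of a linear map, as a linear form in polynomial variables. -/
noncomputable def coordForm {m : ℕ} (B : (Fin m → K) →ₗ[K] (ι → K)) (i : ι) :
    MvPolynomial (Fin m) K :=
  ∑ j, C (B (Pi.single j 1) i) * X j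

theorem eval_coordForm {m : ℕ} (B : (Fin m → K) →ₗ[K] (ι → K)) (i : ι) (w : Fin m → K) :
    eval w (coordForm B i) = B w i := by
  rw [LinearMap.pi_apply_eq_sum_mul_single B w i]
  simp [coordForm, mul_comm]

theorem adjoin_coordForm [Fintype ι] {m : ℕ} (B : (Fin m → K) →ₗ[K] (ι → K)) (hB : Function.Injective B) :
    Algebra.adjoin K (Set.range (coordForm B)) = ⊤ := by
  classical
  obtain ⟨G, hG⟩ := B.exists_leftInverse_of_injective (LinearMap.ker_eq_bot.2 hB)
  rw [eq_top_iff, ← MvPolynomial.adjoin_range_X]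
  refine Algebra.adjoin_le ?_
  rintro _ ⟨j, rfl⟩
  have hX : (X j : MvPolynomial (Fin m) K) = ∑ i, G (Pi.single i 1) j • coordForm B i := by
    have hGB : ∀ k, ∑ i, G (Pi.single i 1) j * B (Pi.single k 1) i =
        (Pi.single k 1 : Fin m → K) j := fun k => by
      have h := LinearMap.congr_fun hG (Pi.single k 1)
      rw [LinearMap.comp_apply, LinearMap.id_apply] at h
      conv_rhs => rw [← h, LinearMap.pi_apply_eq_sum_mul_single G]
      exact Finset.sum_congr rfl fun i _ => mul_comm _ _
    simp only [coordForm, Finset.smul_sum, smul_eq_C_mul, ← mul_assoc, ← C_mul]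
    rw [Finset.sum_comm]
    simp only [← Finset.sum_mul, ← map_sum, hGB]
    simp [Pi.single_apply]
  rw [hX]
  exact Subalgebra.sum_mem _ fun i _ =>
    Subalgebra.smul_mem _ (Algebra.subset_adjoin (Set.mem_range_self i)) _

/-- The points of the torus whose coordinatewise inverse lies in a linear subspace `W`, not
contained in a coordinate hyperplane, form a set of dimension `dim W`. -/
theorem ringKrullDim_inverse_subspace [Fintype ι] [Infinite K] (W : Submodule K (ι → K))
    (hW : ∀ i, ∃ q ∈ W, q i ≠ 0) :
    ringKrullDim (MvPolynomial ι K ⧸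
      affineVanishingIdeal K ι {p : ι → K | (∀ i, p i ≠ 0) ∧ p⁻¹ ∈ W}) =
      Module.finrank K W := by
  let e : W ≃ₗ[K] (Fin (Module.finrank K W) → K) := (Module.finBasis K W).equivFun
  let B : (Fin (Module.finrank K W) → K) →ₗ[K] (ι → K) := W.subtype ∘ₗ e.symm.toLinearMap
  have hB : Function.Injective B := W.injective_subtype.comp e.symm.injective
  have hne : ∀ i, coordForm B i ≠ 0 := by
    intro i h
    obtain ⟨q, hq, hqi⟩ := hW i
    apply hqi
    have hBq : B (e ⟨q, hq⟩) = q := by simp [B]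
    rw [← hBq, ← eval_coordForm, h, map_zero]
  have hset : {p : ι → K | (∀ i, p i ≠ 0) ∧ p⁻¹ ∈ W} = inverseImage (coordForm B) := by
    ext p
    simp only [inverseImage, Set.mem_ofPred_eq, eval_coordForm]
    constructor
    · rintro ⟨hp, hpW⟩
      have hBp : B (e ⟨p⁻¹, hpW⟩) = p⁻¹ := by simp [B]
      refine ⟨e ⟨p⁻¹, hpW⟩, fun i => ?_, ?_⟩
      · rw [hBp]
        exact inv_ne_zero (hp i)
      · rw [hBp]
        ext i
        simp
    · rintro ⟨w, hw, rfl⟩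
      refine ⟨fun i => inv_ne_zero (hw i), ?_⟩
      have : (fun i => (B w i)⁻¹)⁻¹ = B w := by ext i; simp
      rw [this]
      exact (e.symm w).2
  rw [hset, ringKrullDim_quotient_vanishingIdeal_inverseImage _ hne (adjoin_coordForm B hB),
    Fintype.card_fin]

end LinearParametrization

section OrlikTerao

variable {K ι : Type*} [Field K]

theorem aeval_C_mul_X_of_isHomogeneous {f : MvPolynomial ι K} {k : ℕ} (hf : f.IsHomogeneous k)
    (p : ι → K) :
    aeval (fun i => Polynomial.C (p i) * Polynomial.X) f =
      Polynomial.C (eval p f) * Polynomial.X ^ k := by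
  rw [aeval_def, eval₂_eq, eval_eq, map_sum, Finset.sum_mul]
  refine Finset.sum_congr rfl fun s hs => ?_
  have hk : ∑ i ∈ s.support, s i = k := by
    have := hf (mem_support_iff.1 hs)
    simpa [Finsupp.weight_apply, Finsupp.sum] using this
  simp only [mul_pow, Finset.prod_mul_distrib, Finset.prod_pow_eq_pow_sum, hk, map_mul, map_prod,
    map_pow, Polynomial.algebraMap_eq, mul_assoc]

variable [Fintype ι]

theorem mem_vsupp {c : ι → K} {i : ι} : i ∈ vsupp c ↔ c i ≠ 0 := by
  simp [vsupp]

theorem eval_otgen [DecidableEq ι] (c : ι → K) {p : ι → K} (hp : ∀ i, p i ≠ 0) :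
    eval p (otgen c) = (∏ l ∈ vsupp c, p l) * c ⬝ᵥ p⁻¹ := by
  have hdot : c ⬝ᵥ p⁻¹ = ∑ j ∈ vsupp c, c j * (p j)⁻¹ := by
    rw [dotProduct]
    refine (Finset.sum_subset (Finset.subset_univ _) fun j _ hj => ?_).symm
    rw [mem_vsupp, not_not] at hj
    simp [hj]
  rw [hdot, otgen, map_sum, Finset.mul_sum]
  refine Finset.sum_congr rfl fun j hj => ?_
  rw [← Finset.mul_prod_erase _ _ hj]
  have := hp j
  simp only [map_mul, eval_C, map_prod, eval_X]
  field_simp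

theorem isHomogeneous_otgen [DecidableEq ι] (c : ι → K) :
    (otgen c).IsHomogeneous ((vsupp c).card - 1) := by
  refine IsHomogeneous.sum _ _ _ fun j hj => ?_
  rw [← Finset.card_erase_of_mem hj]
  refine IsHomogeneous.C_mul ?_ _
  simpa using IsHomogeneous.prod ((vsupp c).erase j) (fun l => (X l : MvPolynomial ι K))
    (fun _ => 1) fun l _ => isHomogeneous_X K l

namespace CentralArrangement

variable {n : ℕ} (A : CentralArrangement K ι n)

theorem mem_relSpace {c : ι → K} : c ∈ A.relSpace ↔ ∑ i, c i • A.form i = 0 := Iff.rfl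

theorem three_le_card_vsupp {c : ι → K} (hc : c ∈ A.relSpace) (h0 : c ≠ 0) :
    3 ≤ (vsupp c).card := by
  classical
  have hsum : ∑ i ∈ vsupp c, c i • A.form i = 0 := by
    rw [← (A.mem_relSpace).1 hc]
    refine Finset.sum_subset (Finset.subset_univ _) fun j _ hj => ?_
    rw [mem_vsupp, not_not] at hj
    simp [hj]
  by_contra! hlt
  interval_cases h : (vsupp c).card
  · apply h0
    ext i
    by_contra hi
    have := mem_vsupp.2 hi
    rw [Finset.card_eq_zero.1 h] at this
    simp at this
  · obtain ⟨i, hi⟩ := Finset.card_eq_one.1 h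
    have hci : c i ≠ 0 := mem_vsupp.1 (hi ▸ Finset.mem_singleton_self i)
    rw [hi, Finset.sum_singleton, smul_eq_zero] at hsum
    exact hsum.elim hci (A.nonzero i)
  · obtain ⟨i, j, hij, hs⟩ := Finset.card_eq_two.1 h
    have hci : c i ≠ 0 := mem_vsupp.1 (by simp [hs])
    rw [hs, Finset.sum_pair hij] at hsum
    refine A.nonProportional i j hij (-((c i)⁻¹ * c j)) ?_
    rw [add_eq_zero_iff_eq_neg, ← eq_inv_smul_iff₀ hci] at hsum
    rw [hsum, smul_neg, neg_smul, mul_smul]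

/-- The span of the 3-relations. -/
def threeRelSpan : Submodule K (ι → K) :=
  Submodule.span K {c : ι → K | c ∈ A.relSpace ∧ (vsupp c).card = 3}

theorem threeRelSpan_le : A.threeRelSpan ≤ A.relSpace :=
  Submodule.span_le.2 fun _ hc => hc.1

theorem eval_eq_zero_of_mem_otIdeal [DecidableEq ι] {p : ι → K} (hp : ∀ i, p i ≠ 0)
    (h3 : ∀ c ∈ A.relSpace, (vsupp c).card = 3 → c ⬝ᵥ p⁻¹ = 0)
    {f : MvPolynomial ι K} (hf : f ∈ A.otIdeal) (hhom : f.IsHomogeneous 2) :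
    eval p f = 0 := by
  let ψ : MvPolynomial ι K →ₐ[K] Polynomial K :=
    aeval fun i => Polynomial.C (p i) * Polynomial.X
  have hle : A.otIdeal ≤ (Ideal.span {(Polynomial.X : Polynomial K) ^ 3}).comap ψ := by
    refine Ideal.span_le.2 ?_
    rintro _ ⟨c, hc, rfl⟩
    rw [SetLike.mem_coe, Ideal.mem_comap, Ideal.mem_span_singleton,
      aeval_C_mul_X_of_isHomogeneous (isHomogeneous_otgen c) p, eval_otgen c hp]
    by_cases hc0 : c = 0
    · simp [hc0]
    · rcases (A.three_le_card_vsupp hc hc0).eq_or_lt with h | h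
      · simp [h3 c hc h.symm]
      · exact Dvd.dvd.mul_left (pow_dvd_pow _ (by lia)) _
  have hdvd := hle hf
  rw [Ideal.mem_comap, Ideal.mem_span_singleton, aeval_C_mul_X_of_isHomogeneous hhom p,
    Polynomial.X_pow_dvd_iff] at hdvd
  simpa using hdvd 2 (by norm_num)

/-- The annihilator of the span of the 3-relations under the standard dot product. -/
noncomputable def threeRelAnnihilator [DecidableEq ι] : Submodule K (ι → K) :=
  (A.threeRelSpan.map (dotProductEquiv K ι).toLinearMap).dualCoannihilator

theorem mem_threeRelAnnihilator [DecidableEq ι] {q : ι → K} :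
    q ∈ A.threeRelAnnihilator ↔ ∀ c ∈ A.threeRelSpan, c ⬝ᵥ q = 0 := by
  rw [threeRelAnnihilator, Submodule.mem_dualCoannihilator]
  exact ⟨fun h c hc => h _ (Submodule.mem_map_of_mem hc), by
    rintro h _ ⟨c, hc, rfl⟩
    exact h c hc⟩

theorem finrank_threeRelSpan_add [DecidableEq ι] :
    Module.finrank K A.threeRelSpan + Module.finrank K A.threeRelAnnihilator =
      Fintype.card ι := by
  have h := Subspace.finrank_add_finrank_dualCoannihilator_eq
    (A.threeRelSpan.map (dotProductEquiv K ι).toLinearMap)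
  rwa [LinearEquiv.finrank_map_eq, Module.finrank_fintype_fun_eq_card] at h

theorem finrank_relSpace_add : Module.finrank K A.relSpace + n = Fintype.card ι := by
  have hsurj : LinearMap.range A.evalMap = ⊤ := by
    rw [eq_top_iff, ← A.essential, Submodule.span_le]
    rintro _ ⟨i, rfl⟩
    classical
    exact ⟨Pi.single i 1, by simp [evalMap, Pi.single_apply]⟩
  have h := A.evalMap.finrank_range_add_finrank_ker
  rw [hsurj, finrank_top, Module.finrank_fin_fun, Module.finrank_fintype_fun_eq_card] at h
  rw [add_comm, relSpace, h]

theorem affineZeroLocus_otQuadratic_inter_torus [DecidableEq ι] :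
    affineZeroLocus A.otQuadratic ∩ {p : ι → K | ∀ i, p i ≠ 0} =
      {p | (∀ i, p i ≠ 0) ∧ p⁻¹ ∈ A.threeRelAnnihilator} := by
  ext p
  rw [Set.inter_comm]
  refine and_congr_right fun hp => ?_
  rw [mem_threeRelAnnihilator]
  constructor
  · intro h c hc
    have hle : A.threeRelSpan ≤ LinearMap.ker ((dotProductBilin K K).flip p⁻¹) := by
      refine Submodule.span_le.2 fun c hc => ?_
      have hmem : otgen c ∈ A.otQuadratic :=
        Ideal.subset_span ⟨Ideal.subset_span ⟨c, hc.1, rfl⟩, by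
          simpa [hc.2] using isHomogeneous_otgen c⟩
      have h0 := h _ hmem
      rw [eval_otgen c hp, mul_eq_zero] at h0
      exact h0.resolve_left (Finset.prod_ne_zero_iff.2 fun i _ => hp i)
    exact hle hc
  · intro h
    have hle : A.otQuadratic ≤ RingHom.ker (eval p) :=
      Ideal.span_le.2 fun f hf => A.eval_eq_zero_of_mem_otIdeal hp
        (fun c hc hc3 => h c (Submodule.subset_span ⟨hc, hc3⟩)) hf.1 hf.2
    exact fun f hf => hle hf

theorem exists_mem_threeRelAnnihilator_ne_zero [DecidableEq ι] (i : ι) :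
    ∃ q ∈ A.threeRelAnnihilator, q i ≠ 0 := by
  obtain ⟨j, hj⟩ := Function.ne_iff.1 (A.nonzero i)
  refine ⟨fun k => A.form k j, (A.mem_threeRelAnnihilator).2 fun c hc => ?_, hj⟩
  have := congrFun ((A.mem_relSpace).1 (A.threeRelSpan_le hc)) j
  simpa [dotProduct] using this

theorem isTwoFormal_iff_finrank [DecidableEq ι] :
    A.IsTwoFormal ↔ Module.finrank K A.threeRelAnnihilator = n := by
  have h₁ := A.finrank_relSpace_add
  have h₂ := A.finrank_threeRelSpan_add
  constructor
  · intro h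
    have : Module.finrank K A.threeRelSpan = Module.finrank K A.relSpace :=
      congrArg (fun W : Submodule K (ι → K) => Module.finrank K W) h
    lia
  · intro h
    have : Module.finrank K A.threeRelSpan = Module.finrank K A.relSpace := by lia
    exact Submodule.eq_of_le_of_finrank_eq A.threeRelSpan_le this

end CentralArrangement

end OrlikTerao

/-- Let `A` be an essential central arrangement of `d` hyperplanes of rank `n`
over `K = ℂ`, with Orlik-Terao ideal `I` and quadratic component `I₂`.  Then `A` is 2-formal
if and only if `X = V(I₂) ∩ (ℂ*)^d`, the set of points of the affine variety `V(I₂) ⊆ ℂ^d` all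
of whose coordinates are nonzero, has codimension `d − n` in `ℂ^d`, i.e. dimension `n` (the
dimension of `X` being the Krull dimension of its coordinate ring `R/I(X)`). -/
theorem twoFormal_iff_dim_torusPointsOfQuadratic
    (d n : ℕ) (A : CentralArrangement ℂ (Fin d) n) :
    A.IsTwoFormal ↔
      ringKrullDim (MvPolynomial (Fin d) ℂ ⧸
          affineVanishingIdeal ℂ (Fin d)
            (affineZeroLocus A.otQuadratic ∩ {p : Fin d → ℂ | ∀ i, p i ≠ 0})) =
        (n : WithBot (WithTop ℕ)) := by
  rw [A.isTwoFormal_iff_finrank, A.affineZeroLocus_otQuadratic_inter_torus,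
    ringKrullDim_inverse_subspace _ A.exists_mem_threeRelAnnihilator_ne_zero]
  exact Nat.cast_inj.symm
end

section
/- Let A be an essential central arrangement of d hyperplanes over K = ℂ with Orlik–Terao ideal I and quadratic component I_2, and let p = (p_1,…,p_d) ∈ V(I_2) be a point with all coordinates p_i ≠ 0. For a quadratic generator f = a·y_{i}y_{j}·(terms): explicitly, if f = a y_2 y_3 + b y_1 y_3 + c y_1 y_2 = ∂(a e_1 + b e_2 + c e_3) with a,b,c ≠ 0 arises from the dependency a α_1 + b α_2 + c α_3 = 0, then the gradient of f at p equals (−(p_2 p_3/p_1)·a, −(p_1 p_3/p_2)·b, −(p_1 p_2/p_3)·c, 0, …, 0). Consequently, multiplying the Jacobian matrix J_p(I_2) of the quadratic generators of I_2 (evaluated at p) on the right by the invertible diagonal matrix with entries p_1²,…,p_d² and rescaling each row by a nonzero scalar produces exactly the matrix whose rows are the coefficient vectors of the corresponding 3-relations; hence rank J_p(I_2) equals the dimension of the span of the 3-relations in F(A). -/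
open MvPolynomial

open MvPolynomial

theorem Matrix.rank_eq_finrank_span_range_row {K m n : Type*} [Field K] [Fintype n]
    (M : Matrix m n K) :
    M.rank = Module.finrank K (Submodule.span K (Set.range M.row)) := by
  classical
  set Φ := (Submodule.span K (Set.range M.row)).map (dotProductEquiv K n).toLinearMap with hΦ
  have hker : LinearMap.ker M.mulVecLin = Φ.dualCoannihilator := by
    ext v
    rw [hΦ, Submodule.map_span, Submodule.mem_dualCoannihilator, LinearMap.mem_ker]
    constructor
    · intro h φ hφ
      induction hφ using Submodule.span_induction with
      | mem x hx =>
        obtain ⟨_, ⟨i, rfl⟩, rfl⟩ := hx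
        exact congrFun h i
      | zero => simp
      | add x y _ _ hx hy => simp [hx, hy]
      | smul a x _ hx => simp [hx]
    · intro h
      funext i
      exact h (dotProductEquiv K n (M.row i)) (Submodule.subset_span ⟨_, ⟨i, rfl⟩, rfl⟩)
  have hrank := LinearMap.finrank_range_add_finrank_ker M.mulVecLin
  have hdual := Subspace.finrank_add_finrank_dualCoannihilator_eq Φ
  have hmap : Module.finrank K Φ = Module.finrank K (Submodule.span K (Set.range M.row)) :=
    LinearEquiv.finrank_map_eq (dotProductEquiv K n) _
  rw [hker] at hrank
  rw [Matrix.rank]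
  omega

theorem otgen_eq_of_vsupp_eq {K ι : Type*} [Field K] [Fintype ι] [DecidableEq ι] {c : ι → K}
    {i j k : ι} (hij : i ≠ j) (hik : i ≠ k) (hjk : j ≠ k) (hc : vsupp c = {i, j, k}) :
    otgen c = C (c i) * (X j * X k) + C (c j) * (X i * X k) + C (c k) * (X i * X j) := by
  have hi : ({i, j, k} : Finset ι).erase i = {j, k} := by grind
  have hj : ({i, j, k} : Finset ι).erase j = {i, k} := by grind
  have hk : ({i, j, k} : Finset ι).erase k = {i, j} := by grind
  rw [otgen, hc, Finset.sum_insert (by simp [hij, hik]), Finset.sum_pair hjk, hi, hj, hk,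
    Finset.prod_pair hjk, Finset.prod_pair hik, Finset.prod_pair hij, add_assoc]

theorem eval_pderiv_otgen_of_vsupp_eq {K ι : Type*} [Field K] [Fintype ι] [DecidableEq ι]
    {c p : ι → K} {i j k : ι} (hij : i ≠ j) (hik : i ≠ k) (hjk : j ≠ k)
    (hc : vsupp c = {i, j, k}) (hp : p i ≠ 0) (h0 : eval p (otgen c) = 0) :
    eval p (pderiv i (otgen c)) = -(p j * p k / p i) * c i := by
  rw [otgen_eq_of_vsupp_eq hij hik hjk hc] at h0 ⊢
  simp only [map_add, map_mul, eval_C, eval_X] at h0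
  simp only [map_add, Derivation.leibniz, pderiv_C, pderiv_X_self, pderiv_X_of_ne hij.symm,
    pderiv_X_of_ne hik.symm, smul_eq_mul, map_mul, eval_C, eval_X, map_zero, map_one]
  field_simp
  linear_combination h0

theorem pderiv_otgen_of_notMem_vsupp {K ι : Type*} [Field K] [Fintype ι] [DecidableEq ι]
    {c : ι → K} {l : ι} (hl : l ∉ vsupp c) : pderiv l (otgen c) = 0 := by
  refine pderiv_eq_zero_of_notMem_vars fun hmem => hl ?_
  obtain ⟨j, hj, hmem⟩ := Finset.mem_biUnion.1 (vars_sum_subset _ _ hmem)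
  rcases Finset.mem_union.1 (vars_mul _ _ hmem) with h | h
  · simp at h
  · obtain ⟨q, hq, h⟩ := Finset.mem_biUnion.1 (vars_prod _ h)
    rw [vars_X, Finset.mem_singleton] at h
    exact h ▸ Finset.mem_of_mem_erase hq

theorem CentralArrangement.otgen_mem_otQuadratic {K ι : Type*} [Field K] [Fintype ι]
    [DecidableEq ι] {n : ℕ} (A : CentralArrangement K ι n) {c : ι → K} (hc : c ∈ A.relSpace)
    (hcard : (vsupp c).card = 3) : otgen c ∈ A.otQuadratic := by
  refine Ideal.subset_span ⟨Ideal.subset_span ⟨c, hc, rfl⟩, ?_⟩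
  refine IsHomogeneous.sum _ _ _ fun j hj => ?_
  have hprod := IsHomogeneous.prod ((vsupp c).erase j) (fun l => (X l : MvPolynomial ι K))
    (fun _ => 1) fun l _ => isHomogeneous_X K l
  rw [Finset.sum_const, Finset.card_erase_of_mem hj, hcard] at hprod
  exact hprod.C_mul (c j)

/-- Let `A` be an essential central arrangement over `ℂ` with Orlik-Terao
ideal `I` and quadratic component `I₂`, and let `p ∈ V(I₂)` have all coordinates nonzero.
For a quadratic generator `f = ∂(c)` coming from a 3-relation `c` with support `{i,j,k}`
(so `f = c_i y_j y_k + c_j y_i y_k + c_k y_i y_j` arises from the dependency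
`c_i α_i + c_j α_j + c_k α_k = 0` with `c_i, c_j, c_k ≠ 0`), the gradient of `f` at `p` is
`(−(p_j p_k/p_i)·c_i, −(p_i p_k/p_j)·c_j, −(p_i p_j/p_k)·c_k, 0, …, 0)`.  Consequently,
multiplying the Jacobian matrix `J_p(I₂)` of the quadratic generators on the right by the
invertible diagonal matrix `diag(p_1²,…,p_d²)` and rescaling each row by a nonzero scalar
yields exactly the matrix whose rows are the coefficient vectors of the 3-relations; hence
`rank J_p(I₂)` equals the dimension of the span of the 3-relations in `F(A)`. -/
theorem jacobian_otQuadratic_eq_threeRelations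
    (d n : ℕ) (A : CentralArrangement ℂ (Fin d) n)
    (p : Fin d → ℂ) (hp : ∀ i, p i ≠ 0)
    (hpV : ∀ f ∈ A.otQuadratic, eval p f = 0) :
    -- the gradient of a quadratic generator, evaluated at `p`
    (∀ c : Fin d → ℂ, c ∈ A.relSpace → ∀ i j k : Fin d,
        i ≠ j → i ≠ k → j ≠ k → vsupp c = {i, j, k} →
        eval p (pderiv i (otgen c)) = -(p j * p k / p i) * c i ∧
        eval p (pderiv j (otgen c)) = -(p i * p k / p j) * c j ∧
        eval p (pderiv k (otgen c)) = -(p i * p j / p k) * c k ∧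
        ∀ l, l ≠ i → l ≠ j → l ≠ k → eval p (pderiv l (otgen c)) = 0) ∧
    -- right-multiplying the Jacobian by `diag(p_1²,…,p_d²)` and rescaling each row by a
    -- nonzero scalar recovers the coefficient vectors of the corresponding 3-relations
    (∀ c : {c : Fin d → ℂ // c ∈ A.relSpace ∧ (vsupp c).card = 3},
        ∃ t : ℂ, t ≠ 0 ∧
          ∀ l, eval p (pderiv l (otgen c.1)) * (p l) ^ 2 = t * c.1 l) ∧
    -- hence the rank of the Jacobian equals the dimension of the span of the 3-relations
    Matrix.rank
        (Matrix.of fun (c : {c : Fin d → ℂ // c ∈ A.relSpace ∧ (vsupp c).card = 3})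
          (l : Fin d) => eval p (pderiv l (otgen c.1))) =
      Module.finrank ℂ
        ↥(Submodule.span ℂ {c : Fin d → ℂ | c ∈ A.relSpace ∧ (vsupp c).card = 3}) := by
  have h0 : ∀ c ∈ A.relSpace, (vsupp c).card = 3 → eval p (otgen c) = 0 := fun c hc hcard =>
    hpV _ (A.otgen_mem_otQuadratic hc hcard)
  have hgrad : ∀ c : Fin d → ℂ, c ∈ A.relSpace → ∀ i j k : Fin d,
      i ≠ j → i ≠ k → j ≠ k → vsupp c = {i, j, k} →
      eval p (pderiv i (otgen c)) = -(p j * p k / p i) * c i ∧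
      eval p (pderiv j (otgen c)) = -(p i * p k / p j) * c j ∧
      eval p (pderiv k (otgen c)) = -(p i * p j / p k) * c k ∧
      ∀ l, l ≠ i → l ≠ j → l ≠ k → eval p (pderiv l (otgen c)) = 0 := by
    intro c hc i j k hij hik hjk hs
    have hz := h0 c hc (by rw [hs, Finset.card_eq_three]; exact ⟨i, j, k, hij, hik, hjk, rfl⟩)
    refine ⟨eval_pderiv_otgen_of_vsupp_eq hij hik hjk hs (hp i) hz,
      eval_pderiv_otgen_of_vsupp_eq hij.symm hjk hik (by rw [hs]; grind) (hp j) hz,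
      eval_pderiv_otgen_of_vsupp_eq hik.symm hjk.symm hij (by rw [hs]; grind) (hp k) hz,
      fun l hi hj hk => ?_⟩
    rw [pderiv_otgen_of_notMem_vsupp (by simp [hs, hi, hj, hk]), map_zero]
  have hrow : ∀ c : {c : Fin d → ℂ // c ∈ A.relSpace ∧ (vsupp c).card = 3},
      ∃ t : ℂ, t ≠ 0 ∧ ∀ l, eval p (pderiv l (otgen c.1)) * (p l) ^ 2 = t * c.1 l := by
    rintro ⟨c, hc, hcard⟩
    obtain ⟨i, j, k, hij, hik, hjk, hs⟩ := Finset.card_eq_three.1 hcard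
    obtain ⟨hi, hj, hk, hl⟩ := hgrad c hc i j k hij hik hjk hs
    have hpi := hp i
    have hpj := hp j
    have hpk := hp k
    refine ⟨-(p i * p j * p k), by simp [hp], fun l => ?_⟩
    by_cases hli : l = i
    · subst hli; rw [hi]; field_simp
    by_cases hlj : l = j
    · subst hlj; rw [hj]; field_simp
    by_cases hlk : l = k
    · subst hlk; rw [hk]; field_simp
    have hcl : c l = 0 := by
      by_contra hne
      have hmem : l ∈ vsupp c := by simp [vsupp, hne]
      simp [hs, hli, hlj, hlk] at hmem
    simp [hl l hli hlj hlk, hcl]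
  refine ⟨hgrad, hrow, ?_⟩
  rw [← Matrix.rank_mul_eq_left_of_det_ne_zero (Matrix.diagonal fun l => p l ^ 2) _
    (by simp [Matrix.det_diagonal, Finset.prod_ne_zero_iff, hp]),
    Matrix.rank_eq_finrank_span_range_row]
  choose t ht hrow using hrow
  have hscale : ∀ c, ((Matrix.of fun (c : {c : Fin d → ℂ // c ∈ A.relSpace ∧ (vsupp c).card = 3})
      (l : Fin d) => eval p (pderiv l (otgen c.1))) * Matrix.diagonal fun l => p l ^ 2).row c =
      t c • c.1 := by
    intro c
    ext l
    simpa [Matrix.row] using hrow c l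
  refine congrArg (fun W : Submodule ℂ (Fin d → ℂ) => Module.finrank ℂ W) (le_antisymm ?_ ?_) <;>
    rw [Submodule.span_le]
  · rintro _ ⟨c, rfl⟩
    rw [hscale c]
    exact Submodule.smul_mem _ _ (Submodule.subset_span c.2)
  · intro c hc
    rw [← inv_smul_smul₀ (ht ⟨c, hc⟩) c, ← hscale ⟨c, hc⟩]
    exact Submodule.smul_mem _ _ (Submodule.subset_span ⟨_, rfl⟩)
end

section
/- Let A be an essential central arrangement of rank 2 consisting of d ≥ 4 hyperplanes (equivalently, d distinct points in P^1), and let I ⊆ R = K[y_1,…,y_d] be its Orlik–Terao ideal. Then R/I has an Eagon–Northcott resolution, and the only nonzero graded betti numbers in homological degrees i ≥ 1 occur in internal degree i+1, with dim_K Tor_i^R(R/I, K)_{i+1} = i · C(d−1, i+1) for 1 ≤ i ≤ d−2, where C(m,k) is the binomial coefficient. -/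
open MvPolynomial

/-- A minimal graded free resolution of `R/I` over the polynomial ring
`R = K[y_i : i ∈ ι]`:  free graded modules `F_i = ⊕_{r} R(−deg i r)` of rank `rk i`
(with `F_0 = R`), differentials given by matrices of homogeneous polynomials with entries in
the irrelevant maximal ideal (minimality), exact as an augmented complex with
`im(F_1 → F_0) = I` and `rk i = 0` for `i > len`.  The graded Betti number
`b_{i,j} = dim_K Tor_i^R(R/I, K)_j` is then the number of indices `r` with `deg i r = j`. -/
structure MinGradedFreeRes (K : Type*) [Field K] (ι : Type*) [Fintype ι]
    (I : Ideal (MvPolynomial ι K)) where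
  /-- the length of the resolution -/
  len : ℕ
  /-- the rank of the free module `F_i` -/
  rk : ℕ → ℕ
  rk_zero : rk 0 = 1
  rk_eventually_zero : ∀ i, len < i → rk i = 0
  /-- the internal degrees of the free generators of `F_i` -/
  deg : (i : ℕ) → Fin (rk i) → ℕ
  deg_zero : ∀ r, deg 0 r = 0
  /-- the matrix of the differential `F_{i+1} → F_i` -/
  mat : (i : ℕ) → Matrix (Fin (rk (i + 1))) (Fin (rk i)) (MvPolynomial ι K)
  /-- the differentials are graded of degree 0 -/
  homog : ∀ i r c, (mat i r c).IsHomogeneous (deg (i + 1) r - deg i c)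
  /-- minimality: all entries lie in the irrelevant maximal ideal -/
  minimal : ∀ i r c, MvPolynomial.coeff 0 (mat i r c) = 0
  /-- exactness of the complex -/
  exact : ∀ i,
    LinearMap.range (mat (i + 1)).vecMulLinear = LinearMap.ker (mat i).vecMulLinear
  /-- the image of `F_1 → F_0 = R` is exactly `I` -/
  aug : LinearMap.range (mat 0).vecMulLinear =
    Submodule.pi Set.univ
      fun _ : Fin (rk 0) => (I : Submodule (MvPolynomial ι K) (MvPolynomial ι K))

section Koszul

open Finset

variable {ι A : Type*} [LinearOrder ι] [CommRing A]

/-- The sign of `e_j ∧ e_J` relative to the increasingly ordered basis vector. -/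
def insSign (A : Type*) [CommRing A] (j : ι) (J : Finset ι) : A :=
  (-1) ^ #{k ∈ J | k < j}

lemma insSign_mul_self (j : ι) (J : Finset ι) : insSign A j J * insSign A j J = 1 := by
  rw [insSign, ← pow_add, ← two_mul, pow_mul]
  simp

lemma insSign_insert {j k : ι} {J : Finset ι} (hk : k ∉ J) :
    insSign A j (insert k J) = if k < j then -insSign A j J else insSign A j J := by
  unfold insSign
  rw [filter_insert]
  split_ifs
  · rw [card_insert_of_notMem (by simp [hk]), pow_succ, mul_neg_one]
  · rfl

variable [Fintype ι]

/-- Contraction of (the coefficients of) an element of the exterior algebra by the linear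
form `u`. -/
def contract (u : ι → A) : (Finset ι → A) →ₗ[A] (Finset ι → A) where
  toFun f J := ∑ j ∈ Jᶜ, insSign A j J * (u j * f (insert j J))
  map_add' f g := by
    ext J
    simp only [Pi.add_apply, mul_add, sum_add_distrib]
  map_smul' t f := by
    ext J
    simp only [Pi.smul_apply, smul_eq_mul, RingHom.id_apply, mul_sum]
    exact sum_congr rfl fun j _ => by ring

lemma contract_apply (u : ι → A) (f : Finset ι → A) (J : Finset ι) :
    contract u f J = ∑ j ∈ Jᶜ, insSign A j J * (u j * f (insert j J)) := rfl

lemma contract_contract_apply (u v : ι → A) (f : Finset ι → A) (J : Finset ι) :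
    contract u (contract v f) J =
      ∑ p ∈ (Jᶜ ×ˢ Jᶜ) with p.1 < p.2, insSign A p.1 J * insSign A p.2 J *
        (u p.2 * v p.1 - u p.1 * v p.2) * f (insert p.1 (insert p.2 J)) := by
  have key : contract u (contract v f) J =
      ∑ p ∈ (Jᶜ ×ˢ Jᶜ) with p.1 ≠ p.2, insSign A p.1 J * (u p.1 *
        (insSign A p.2 (insert p.1 J) * (v p.2 * f (insert p.2 (insert p.1 J))))) := by
    rw [sum_filter, sum_product, contract_apply]
    refine sum_congr rfl fun j hj => ?_
    rw [contract_apply, mul_sum, mul_sum, ← sum_filter]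
    refine sum_congr ?_ fun _ _ => rfl
    ext k
    simp only [mem_compl, mem_insert, mem_filter]
    grind
  have split : ((Jᶜ ×ˢ Jᶜ).filter fun p : ι × ι => p.1 ≠ p.2) =
      ((Jᶜ ×ˢ Jᶜ).filter fun p : ι × ι => p.1 < p.2) ∪
        ((Jᶜ ×ˢ Jᶜ).filter fun p : ι × ι => p.2 < p.1) := by
    rw [← filter_or]
    simp only [lt_or_lt_iff_ne]
  have swap : ∀ F : ι × ι → A, ∑ p ∈ (Jᶜ ×ˢ Jᶜ) with p.2 < p.1, F p =
      ∑ p ∈ (Jᶜ ×ˢ Jᶜ) with p.1 < p.2, F p.swap := by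
    intro F
    refine sum_nbij' Prod.swap Prod.swap ?_ ?_ ?_ ?_ ?_ <;> simp +contextual
  rw [key, split, sum_union, swap, ← sum_add_distrib]
  · refine sum_congr rfl fun p hp => ?_
    simp only [mem_filter, mem_product, mem_compl] at hp
    obtain ⟨⟨h1, h2⟩, h⟩ := hp
    simp only [Prod.fst_swap, Prod.snd_swap]
    rw [insSign_insert h1, insSign_insert h2, if_pos h, if_neg h.not_gt, insert_comm p.2 p.1]
    ring
  · rw [disjoint_filter]
    exact fun p _ h => h.not_gt

lemma contract_comm (u v : ι → A) (f : Finset ι → A) :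
    contract u (contract v f) = -contract v (contract u f) := by
  ext J
  rw [Pi.neg_apply, contract_contract_apply, contract_contract_apply, ← sum_neg_distrib]
  exact sum_congr rfl fun p _ => by ring

lemma contract_self (u : ι → A) (f : Finset ι → A) : contract u (contract u f) = 0 := by
  ext J
  rw [contract_contract_apply, Pi.zero_apply]
  exact sum_eq_zero fun p _ => by ring

/-- Exterior multiplication by the basis vector `e_q`. -/
def wedge (q : ι) (f : Finset ι → A) (J : Finset ι) : A :=
  if q ∈ J then insSign A q J * f (J.erase q) else 0

lemma contract_wedge (u : ι → A) (q : ι) (f : Finset ι → A) (J : Finset ι) :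
    contract u (wedge q f) J = u q * f J - wedge q (contract u f) J := by
  by_cases hq : q ∈ J
  · obtain ⟨I, hI, rfl⟩ : ∃ I, q ∉ I ∧ J = insert q I :=
      ⟨J.erase q, notMem_erase q J, (insert_erase hq).symm⟩
    have hc : Iᶜ = insert q (insert q I)ᶜ := by
      ext k
      simp only [mem_compl, mem_insert]
      grind
    have hs : insSign A q (insert q I) = insSign A q I := by simp [insSign_insert hI]
    rw [wedge, if_pos hq, erase_insert hI, contract_apply, contract_apply, hc,
      sum_insert (by simp), mul_add, hs]
    have h1 := insSign_mul_self (A := A) q I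
    have : ∀ j ∈ (insert q I)ᶜ, insSign A j (insert q I) *
        (u j * wedge q f (insert j (insert q I))) =
        -(insSign A q I * (insSign A j I * (u j * f (insert j I)))) := by
      intro j hj
      simp only [mem_compl, mem_insert, not_or] at hj
      have hq' : q ∉ insert j I := by simp [hI, Ne.symm hj.1]
      rw [wedge, if_pos (by simp), insert_comm j q I, erase_insert hq', insSign_insert hI,
        insSign_insert hq', insSign_insert hj.2]
      rcases lt_or_gt_of_ne hj.1 with h | h
      · simp only [lt_irrefl, if_false, if_pos h, if_neg h.not_gt]
        ring
      · simp only [lt_irrefl, if_false, if_pos h, if_neg h.not_gt]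
        ring
    rw [sum_congr rfl this, sum_neg_distrib, ← mul_sum]
    linear_combination (u q * f (insert q I)) * h1
  · rw [wedge, if_neg hq, sub_zero, contract_apply, sum_eq_single q]
    · rw [wedge, if_pos (mem_insert_self q J), erase_insert hq, insSign_insert hq]
      have h1 := insSign_mul_self (A := A) q J
      simp only [lt_irrefl, if_false]
      linear_combination (u q * f J) * h1
    · intro j _ hj
      rw [wedge, if_neg (by simp [hq, Ne.symm hj]), mul_zero, mul_zero]
    · simp [hq]

/-- The differential `Λ^{k+1} ⊗ D_{n+1} → Λ^k ⊗ D_n` of the Eagon–Northcott complex of the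
`2 × m` matrix with rows `u`, `v`.  The value `f J a` is the coefficient of `e_J` tensored
with the `a`-th divided power basis element. -/
def enD (u v : ι → A) : (Finset ι → ℕ → A) →ₗ[A] (Finset ι → ℕ → A) where
  toFun f J a := contract u (fun I => f I (a + 1)) J + contract v (fun I => f I a) J
  map_add' f g := by
    ext J a
    change contract u ((fun I => f I (a + 1)) + fun I => g I (a + 1)) J +
      contract v ((fun I => f I a) + fun I => g I a) J = _
    simp only [map_add, Pi.add_apply]
    ring
  map_smul' t f := by
    ext J a
    change contract u (t • fun I => f I (a + 1)) J + contract v (t • fun I => f I a) J = _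
    simp only [map_smul, Pi.smul_apply, smul_eq_mul, RingHom.id_apply]
    ring

lemma enD_apply (u v : ι → A) (f : Finset ι → ℕ → A) (J : Finset ι) (a : ℕ) :
    enD u v f J a = contract u (fun I => f I (a + 1)) J + contract v (fun I => f I a) J := rfl

lemma enD_slice (u v : ι → A) (f : Finset ι → ℕ → A) (a : ℕ) :
    (fun J => enD u v f J a) = contract u (fun I => f I (a + 1)) + contract v fun I => f I a :=
  rfl

lemma enD_enD (u v : ι → A) (f : Finset ι → ℕ → A) : enD u v (enD u v f) = 0 := by
  ext J a
  rw [enD_apply, enD_slice, enD_slice, map_add, map_add, contract_self, contract_self,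
    contract_comm u v]
  simp

/-- The augmentation of the Eagon–Northcott complex, given by the `2 × 2` minors. -/
def enAug (u v : ι → A) : (Finset ι → ℕ → A) →ₗ[A] A where
  toFun f := contract u (contract v fun I => f I 0) ∅
  map_add' f g := by
    change contract u (contract v ((fun I => f I 0) + fun I => g I 0)) ∅ = _
    simp only [map_add, Pi.add_apply]
  map_smul' t f := by
    change contract u (contract v (t • fun I => f I 0)) ∅ = _
    simp only [map_smul, Pi.smul_apply, RingHom.id_apply]

lemma enAug_apply (u v : ι → A) (f : Finset ι → ℕ → A) :
    enAug u v f = contract u (contract v fun I => f I 0) ∅ := rfl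

lemma enAug_enD (u v : ι → A) (f : Finset ι → ℕ → A) : enAug u v (enD u v f) = 0 := by
  rw [enAug_apply, enD_slice, map_add, map_add, contract_self, contract_comm v u, map_neg,
    contract_self]
  simp

/-- The component of `f` in `Λ^{n+2} ⊗ D_n` is a cycle of the augmented Eagon–Northcott
complex. -/
def IsENCycle (u v : ι → A) (n : ℕ) (f : Finset ι → ℕ → A) : Prop :=
  (n = 0 → enAug u v f = 0) ∧ ∀ J, #J = n + 1 → ∀ a < n, enD u v f J a = 0

lemma IsENCycle.sub_enD {u v : ι → A} {n : ℕ} {f : Finset ι → ℕ → A}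
    (hf : IsENCycle u v n f) (g : Finset ι → ℕ → A) : IsENCycle u v n (f - enD u v g) := by
  constructor
  · intro hn
    rw [map_sub, hf.1 hn, enAug_enD, sub_zero]
  · intro J hJ a ha
    rw [map_sub, enD_enD, sub_zero, hf.2 J hJ a ha]

/-- Exactness of the Eagon–Northcott complex of a constant matrix with rows `1` and `lam`,
restricted to the columns in `B`. -/
lemma IsENCycle.exists_enD_eq_of_field {K : Type*} [Field K] {lam : ι → K}
    (hlam : Function.Injective lam) (B : Finset ι) {n : ℕ} {f : Finset ι → ℕ → K}
    (hfB : ∀ J, ¬ J ⊆ B → f J = 0) (hf : IsENCycle 1 lam n f) :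
    ∃ g : Finset ι → ℕ → K, (∀ J, ¬ J ⊆ B → g J = 0) ∧
      ∀ J, #J = n + 2 → ∀ a ≤ n, enD 1 lam g J a = f J a := by
  rcases le_or_gt #B 1 with hB | hB
  · refine ⟨0, fun _ _ => rfl, fun J hJ a _ => ?_⟩
    rw [hfB J fun h => by have := card_le_card h; omega, map_zero]
    rfl
  obtain ⟨p, hp, q, hq, hpq⟩ := one_lt_card.1 hB
  have hsub : ∀ {r J}, r ∈ B → ¬ J ⊆ B → ¬ J.erase r ⊆ B := by
    intro r J hr hJ h
    exact hJ fun x hx => by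
      by_cases hxr : x = r
      · exact hxr ▸ hr
      · exact h (mem_erase.2 ⟨hxr, hx⟩)
  let G : (ℕ → K) → ℕ → K := fun s a => Nat.rec 0 (fun k x => s k - lam p * x) a
  have hG : ∀ s a, G s (a + 1) = s a - lam p * G s a := fun _ _ => rfl
  have hG0 : ∀ a, G 0 a = 0 := by
    intro a
    induction a with
    | zero => rfl
    | succ a ih => rw [hG, ih]; simp
  let g₁ : Finset ι → ℕ → K := fun J a => wedge p (fun I => G (f I) a) J
  have hg₁ : ∀ J, ¬ J ⊆ B → g₁ J = 0 := by
    intro J hJ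
    ext a
    simp only [g₁, wedge, hfB _ (hsub hp hJ), hG0]
    simp
  set f' := f - enD 1 lam g₁ with hf'
  have hcyc : IsENCycle 1 lam n f' := hf.sub_enD g₁
  have hf'p : ∀ J, p ∉ J → f' J = 0 := by
    intro J hJ
    ext a
    simp only [hf', Pi.sub_apply, enD_apply, g₁, contract_wedge]
    simp only [wedge, if_neg hJ, hG]
    simp
  have hgeom : ∀ J, #J = n + 2 → ∀ a ≤ n, f' J a = (-lam p) ^ a * f' J 0 := by
    intro J hJ a
    by_cases hpJ : p ∈ J
    · induction a with
      | zero => simp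
      | succ a ih =>
        intro ha
        have h := hcyc.2 (J.erase p) (by rw [card_erase_of_mem hpJ]; omega) a (by omega)
        rw [enD_apply, contract_apply, contract_apply, sum_eq_single p, sum_eq_single p,
          insert_erase hpJ] at h
        · have h2 := insSign_mul_self (A := K) p (J.erase p)
          rw [pow_succ, ← neg_mul_comm, mul_assoc]
          have ih' := ih (by omega)
          simp only [Pi.one_apply] at h
          linear_combination (insSign K p (J.erase p)) * h -
            (f' J (a + 1) + lam p * f' J a) * h2 - lam p * ih'
        · intro j _ hj
          rw [hf'p _ (by simp [Ne.symm hj])]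
          simp
        · simp
        · intro j _ hj
          rw [hf'p _ (by simp [Ne.symm hj])]
          simp
        · simp
    · simp [hf'p J hpJ]
  let nu : ι → K := fun j => lam j - lam p
  have hcontract : ∀ (c : Finset ι → K) J, contract nu c J =
      contract lam c J - lam p * contract 1 c J := by
    intro c J
    simp only [contract_apply, mul_sum, ← sum_sub_distrib, nu, Pi.one_apply]
    exact sum_congr rfl fun j _ => by ring
  have hnuq : nu q ≠ 0 := sub_ne_zero.2 fun h => hpq (hlam h).symm
  let c : Finset ι → K := fun J => f' J 0
  have hc : ∀ J, #J = n + 1 → contract nu c J = 0 := by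
    intro J hJ
    rcases Nat.eq_zero_or_pos n with rfl | hn
    · obtain ⟨j, rfl⟩ := card_eq_one.1 hJ
      have hne : ∀ k, k ≠ p → contract nu c {k} = 0 := by
        intro k hk
        rw [contract_apply]
        refine sum_eq_zero fun l _ => ?_
        by_cases hl : l = p
        · simp [nu, hl]
        · simp only [c, hf'p _ (show p ∉ insert l {k} by simp [Ne.symm hl, Ne.symm hk])]
          simp
      by_cases hj : j = p
      · subst hj
        have h0 : contract 1 (contract nu c) ∅ = 0 := by
          have : contract nu c = contract lam c - lam j • contract 1 c := by
            ext J
            simp [hcontract]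
          rw [this, map_sub, map_smul, contract_self]
          simpa [enAug_apply] using hcyc.1 rfl
        rw [contract_apply, sum_eq_single j] at h0
        · simpa [insSign] using h0
        · intro k _ hk
          have := hne k hk
          simp only [insert_empty_eq, this, mul_zero]
        · simp
      · exact hne j hj
    · have h := hcyc.2 J hJ 0 hn
      rw [enD_apply] at h
      rw [hcontract, ← h, add_comm, sub_eq_add_neg]
      congr 1
      simp only [contract_apply, mul_sum, ← sum_neg_distrib]
      refine sum_congr rfl fun j hj => ?_
      rw [hgeom (insert j J) (by rw [card_insert_of_notMem (by simpa using hj)]; omega) (0 + 1)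
        (by omega)]
      simp only [c]
      ring
  let g₂ : Finset ι → ℕ → K := fun J a => (-lam p) ^ a * ((nu q)⁻¹ * wedge q c J)
  refine ⟨g₁ + g₂, ?_, ?_⟩
  · intro J hJ
    ext a
    have hz : c (J.erase q) = 0 := by
      have h1 := hsub hq hJ
      have hz1 : ∀ a j, g₁ (insert j (J.erase q)) a = 0 := fun a j => by
        rw [hg₁ _ fun h => h1 ((subset_insert _ _).trans h)]
        rfl
      simp only [c, hf', Pi.sub_apply, hfB _ h1, enD_apply, contract_apply, hz1]
      simp
    simp [g₂, hg₁ J hJ, wedge, hz]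
  · intro J hJ a ha
    have h2 : enD 1 lam g₂ J a = (-lam p) ^ a * ((nu q)⁻¹ * contract nu (wedge q c) J) := by
      rw [hcontract, enD_apply]
      simp only [contract_apply, mul_sum, ← sum_add_distrib, ← sum_sub_distrib, g₂]
      refine sum_congr rfl fun j _ => ?_
      simp only [Pi.one_apply]
      ring
    have h3 : wedge q (contract nu c) J = 0 := by
      rw [wedge]
      split_ifs with h
      · rw [hc _ (by rw [card_erase_of_mem h]; omega), mul_zero]
      · rfl
    rw [map_add, Pi.add_apply, Pi.add_apply, h2, contract_wedge, h3, sub_zero,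
      inv_mul_cancel_left₀ hnuq, ← hgeom J hJ a ha]
    simp [hf']

end Koszul

section PolynomialENComplex

open Finset

variable {K : Type*} [Field K] {m : ℕ}

/-- The exponent vector of the squarefree monomial `∏_{j ∈ J} y_{j+1}`. -/
noncomputable def sqfreeExp (J : Finset (Fin m)) : Fin (m + 1) →₀ ℕ :=
  ∑ j ∈ J, Finsupp.single j.succ 1

lemma sqfreeExp_succ (J : Finset (Fin m)) (k : Fin m) :
    sqfreeExp J k.succ = if k ∈ J then 1 else 0 := by
  simp [sqfreeExp, Finsupp.finsetSum_apply, Finsupp.single_apply]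

lemma sqfreeExp_zero (J : Finset (Fin m)) : sqfreeExp J 0 = 0 := by
  simp [sqfreeExp, Finsupp.finsetSum_apply]

lemma sqfreeExp_insert {j : Fin m} {J : Finset (Fin m)} (hj : j ∉ J) :
    sqfreeExp (insert j J) = sqfreeExp J + Finsupp.single j.succ 1 := by
  simp only [sqfreeExp, sum_insert hj]
  exact add_comm _ _

lemma sqfreeExp_le {J : Finset (Fin m)} {b : Fin (m + 1) →₀ ℕ} :
    sqfreeExp J ≤ b ↔ J ⊆ univ.filter fun j => 0 < b j.succ := by
  rw [Finsupp.le_def, Fin.forall_fin_succ, sqfreeExp_zero]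
  simp only [sqfreeExp_succ, subset_iff, mem_filter, mem_univ, true_and, Nat.zero_le]
  refine forall_congr' fun j => ?_
  split_ifs with h <;> simp [h, Nat.one_le_iff_ne_zero, Nat.pos_iff_ne_zero]

/-- The degree of a monomial in the variables `y_1, …, y_m`, ignoring `y_0`. -/
def tailDegree : (Fin (m + 1) →₀ ℕ) →+ ℕ where
  toFun c := ∑ j : Fin m, c j.succ
  map_zero' := by simp
  map_add' c d := by simp [sum_add_distrib]

lemma tailDegree_single_succ (j : Fin m) (k : ℕ) :
    tailDegree (Finsupp.single j.succ k) = k := by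
  simp [tailDegree, Finsupp.single_apply]

lemma tailDegree_single_zero (k : ℕ) :
    tailDegree (Finsupp.single (0 : Fin (m + 1)) k) = 0 := by
  simp [tailDegree, Fin.succ_ne_zero]

lemma tailDegree_sqfreeExp (J : Finset (Fin m)) : tailDegree (sqfreeExp J) = #J := by
  simp [sqfreeExp, tailDegree_single_succ]

/-- The vector of linear forms `l_j y_{j+1} + μ_j y_0`. -/
noncomputable def linRow (l mu : Fin m → K) (j : Fin m) : MvPolynomial (Fin (m + 1)) K :=
  C (l j) * X j.succ + C (mu j) * X 0

/-- The part of multidegree `b` of `∑ f_J e_J`, where `e_J` has the multidegree of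
`∏_{j ∈ J} y_{j+1}`. -/
noncomputable def multidegPart (b : Fin (m + 1) →₀ ℕ)
    (f : Finset (Fin m) → MvPolynomial (Fin (m + 1)) K) (J : Finset (Fin m)) : K :=
  open Classical in if sqfreeExp J ≤ b then coeff (b - sqfreeExp J) (f J) else 0

lemma C_insSign (j : Fin m) (J : Finset (Fin m)) :
    insSign (MvPolynomial (Fin (m + 1)) K) j J = C (insSign K j J) := by
  simp [insSign]

lemma multidegPart_contract (l mu : Fin m → K) (b : Fin (m + 1) →₀ ℕ)
    (f : Finset (Fin m) → MvPolynomial (Fin (m + 1)) K) (J : Finset (Fin m))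
    (h : ∀ j ∉ J, mu j = 0 ∨ coeff (b - sqfreeExp J) (X 0 * f (insert j J)) = 0) :
    multidegPart b (contract (linRow l mu) f) J = contract l (multidegPart b f) J := by
  by_cases hJ : sqfreeExp J ≤ b
  · rw [multidegPart, if_pos hJ, contract_apply, contract_apply, coeff_sum]
    refine sum_congr rfl fun j hj => ?_
    rw [mem_compl] at hj
    have h0 : mu j * coeff (b - sqfreeExp J) (X 0 * f (insert j J)) = 0 := by
      rcases h j hj with h | h <;> simp [h]
    rw [C_insSign, coeff_C_mul, linRow, add_mul, coeff_add, mul_assoc, mul_assoc, coeff_C_mul,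
      coeff_C_mul, h0, add_zero, coeff_X_mul', multidegPart, sqfreeExp_insert hj,
      tsub_add_eq_tsub_tsub]
    have hiff : j.succ ∈ (b - sqfreeExp J).support ↔
        sqfreeExp J + Finsupp.single j.succ 1 ≤ b := by
      rw [← sqfreeExp_insert hj, sqfreeExp_le, insert_subset_iff, ← sqfreeExp_le]
      simp [hJ, sqfreeExp_succ, hj, Nat.pos_iff_ne_zero]
    simp only [hiff]
  · rw [multidegPart, if_neg hJ, contract_apply]
    symm
    refine sum_eq_zero fun j _ => ?_
    rw [multidegPart, if_neg, mul_zero, mul_zero]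
    rw [sqfreeExp_le] at hJ ⊢
    exact fun h => hJ ((subset_insert _ _).trans h)

/-- All terms of `f`, in the component spanned by the `e_J` with `J` of size `k`, have degree
at most `N` with respect to `y_1, …, y_m`, where `e_J` has degree `#J`. -/
def HasWeightLE (k N : ℕ) (f : Finset (Fin m) → MvPolynomial (Fin (m + 1)) K) : Prop :=
  ∀ J, #J = k → ∀ c, coeff c (f J) ≠ 0 → tailDegree c + k ≤ N

lemma multidegPart_contract_of_hasWeightLE (l mu : Fin m → K) {b : Fin (m + 1) →₀ ℕ} {N k : ℕ}
    {f : Finset (Fin m) → MvPolynomial (Fin (m + 1)) K} (hf : HasWeightLE (k + 1) N f)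
    (hb : N ≤ tailDegree b) {J : Finset (Fin m)} (hJ : #J = k) :
    multidegPart b (contract (linRow l mu) f) J = contract l (multidegPart b f) J := by
  by_cases hJb : sqfreeExp J ≤ b
  · refine multidegPart_contract l mu b f J fun j hj => Or.inr ?_
    rw [coeff_X_mul']
    split_ifs with h0
    · by_contra hne
      have h1 := hf _ (by rw [card_insert_of_notMem hj, hJ]) _ hne
      have h2 : b = (b - sqfreeExp J - Finsupp.single 0 1) + Finsupp.single 0 1 +
          sqfreeExp J := by
        rw [tsub_add_cancel_of_le, tsub_add_cancel_of_le hJb]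
        simpa [Nat.one_le_iff_ne_zero] using h0
      rw [h2, map_add, map_add, tailDegree_single_zero, tailDegree_sqfreeExp, hJ] at hb
      omega
    · rfl
  · rw [multidegPart, if_neg hJb, contract_apply]
    symm
    refine sum_eq_zero fun j _ => ?_
    rw [multidegPart, if_neg, mul_zero, mul_zero]
    rw [sqfreeExp_le] at hJb ⊢
    exact fun h => hJb ((subset_insert _ _).trans h)

lemma multidegPart_add (b : Fin (m + 1) →₀ ℕ)
    (f g : Finset (Fin m) → MvPolynomial (Fin (m + 1)) K) :
    multidegPart b (f + g) = multidegPart b f + multidegPart b g := by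
  ext J
  simp only [multidegPart, Pi.add_apply, coeff_add]
  split_ifs <;> simp

lemma coeff_eq_multidegPart (c : Fin (m + 1) →₀ ℕ)
    (f : Finset (Fin m) → MvPolynomial (Fin (m + 1)) K) (J : Finset (Fin m)) :
    coeff c (f J) = multidegPart (c + sqfreeExp J) f J := by
  rw [multidegPart, if_pos le_add_self, add_tsub_cancel_right]

lemma multidegPart_enD (mu lam : Fin m → K) {b : Fin (m + 1) →₀ ℕ} {N k : ℕ}
    {f : Finset (Fin m) → ℕ → MvPolynomial (Fin (m + 1)) K} {a : ℕ}
    (hf : HasWeightLE (k + 1) N fun J => f J a)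
    (hb : N ≤ tailDegree b) {J : Finset (Fin m)} (hJ : #J = k) :
    multidegPart b (fun J => enD (linRow 1 0) (linRow lam mu) f J a) J =
      enD 1 lam (fun J a => multidegPart b (fun J => f J a) J) J a := by
  rw [enD_slice, multidegPart_add, Pi.add_apply, enD_apply,
    multidegPart_contract_of_hasWeightLE lam mu hf hb hJ,
    multidegPart_contract 1 0 b _ J fun j _ => Or.inl rfl]

lemma IsENCycle.map_multidegPart {mu lam : Fin m → K} {b : Fin (m + 1) →₀ ℕ} {N n : ℕ}
    {f : Finset (Fin m) → ℕ → MvPolynomial (Fin (m + 1)) K}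
    (hcyc : IsENCycle (linRow 1 0) (linRow lam mu) n f)
    (hf : ∀ a ≤ n, HasWeightLE (n + 2) N fun J => f J a) (hb : N ≤ tailDegree b) :
    IsENCycle 1 lam n fun J a => multidegPart b (fun J => f J a) J := by
  constructor
  · rintro rfl
    have h := congrArg (coeff b) (hcyc.1 rfl)
    have h2 := coeff_eq_multidegPart b
      (contract (linRow 1 0) (contract (linRow lam mu) fun I => f I 0)) ∅
    rw [enAug_apply, h2, coeff_zero] at h
    have h3 : b + sqfreeExp (∅ : Finset (Fin m)) = b := by simp [sqfreeExp]
    rw [h3, multidegPart_contract 1 0 b _ _ fun j _ => Or.inl rfl] at h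
    rw [enAug_apply, ← h, contract_apply, contract_apply]
    refine sum_congr rfl fun j _ => ?_
    rw [multidegPart_contract_of_hasWeightLE lam mu (hf 0 le_rfl) hb (by simp)]
  · intro J hJ a ha
    rw [← multidegPart_enD mu lam (hf a ha.le) hb hJ, multidegPart, hcyc.2 J hJ a ha]
    simp

/-- Exactness of the Eagon–Northcott complex of the matrix with rows `y_j` and
`lam_j y_j + mu_j y_0`. -/
lemma IsENCycle.exists_enD_eq {mu lam : Fin m → K} (hlam : Function.Injective lam) {n : ℕ}
    {f : Finset (Fin m) → ℕ → MvPolynomial (Fin (m + 1)) K}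
    (hcyc : IsENCycle (linRow 1 0) (linRow lam mu) n f) :
    ∃ w : Finset (Fin m) → ℕ → MvPolynomial (Fin (m + 1)) K,
      ∀ J, #J = n + 2 → ∀ a ≤ n, enD (linRow 1 0) (linRow lam mu) w J a = f J a := by
  classical
  obtain ⟨N, hN⟩ : ∃ N, ∀ a ≤ n, HasWeightLE (n + 2) N fun J => f J a := by
    refine ⟨∑ J : Finset (Fin m), ∑ a ∈ range (n + 1), ∑ c ∈ (f J a).support,
      (tailDegree c + (n + 2)), fun a ha J _ c hc => ?_⟩
    calc tailDegree c + (n + 2)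
        ≤ ∑ c ∈ (f J a).support, (tailDegree c + (n + 2)) :=
          single_le_sum (f := fun c => tailDegree c + (n + 2)) (fun _ _ => Nat.zero_le _)
            (mem_support_iff.2 hc)
      _ ≤ ∑ a ∈ range (n + 1), ∑ c ∈ (f J a).support, (tailDegree c + (n + 2)) :=
          single_le_sum (f := fun a => ∑ c ∈ (f J a).support, (tailDegree c + (n + 2)))
            (fun _ _ => Nat.zero_le _) (mem_range.2 (by omega))
      _ ≤ _ := single_le_sum (f := fun J => ∑ a ∈ range (n + 1), ∑ c ∈ (f J a).support,
            (tailDegree c + (n + 2))) (fun _ _ => Nat.zero_le _) (mem_univ J)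
  induction N generalizing f with
  | zero =>
    refine ⟨0, fun J hJ a ha => ?_⟩
    rw [map_zero]
    symm
    ext c
    by_contra hc
    have := hN a ha J hJ c hc
    omega
  | succ N ih =>
    let S : Finset (Fin (m + 1) →₀ ℕ) := (univ.biUnion fun J : Finset (Fin m) =>
      (range (n + 1)).biUnion fun a => (f J a).support.image (· + sqfreeExp J)).filter
        fun b => tailDegree b = N + 1
    have hS : ∀ b, tailDegree b = N + 1 → b ∉ S → ∀ J, ∀ a ≤ n,
        multidegPart b (fun J => f J a) J = 0 := by
      intro b hb hbS J a ha
      rw [multidegPart]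
      split_ifs with hle
      · by_contra hne
        refine hbS (mem_filter.2 ⟨mem_biUnion.2 ⟨J, mem_univ J, mem_biUnion.2 ⟨a,
          mem_range.2 (by omega), mem_image.2 ⟨_, mem_support_iff.2 hne, ?_⟩⟩⟩, hb⟩)
        exact tsub_add_cancel_of_le hle
      · rfl
    have hex : ∀ b, ∃ g : Finset (Fin m) → ℕ → K, (∀ J, ¬ sqfreeExp J ≤ b → g J = 0) ∧
        (b ∉ S → g = 0) ∧ (tailDegree b = N + 1 → ∀ J, #J = n + 2 → ∀ a ≤ n,
          enD 1 lam g J a = multidegPart b (fun J => f J a) J) := by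
      intro b
      by_cases hb : b ∈ S
      · have hbN : tailDegree b = N + 1 := (mem_filter.1 hb).2
        obtain ⟨g, hg, hg'⟩ := (hcyc.map_multidegPart hN hbN.ge).exists_enD_eq_of_field hlam
          (univ.filter fun j => 0 < b j.succ) (fun J hJ => by
            ext a
            rw [multidegPart, if_neg (mt sqfreeExp_le.1 hJ)]
            rfl)
        exact ⟨g, fun J hJ => hg J (mt sqfreeExp_le.2 hJ), fun h => absurd hb h, fun _ => hg'⟩
      · refine ⟨0, fun _ _ => rfl, fun _ => rfl, fun hbN J _ a ha => ?_⟩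
        rw [map_zero, hS b hbN hb J a ha]
        rfl
    choose g hg hgS hgN using hex
    let w : Finset (Fin m) → ℕ → MvPolynomial (Fin (m + 1)) K := fun J a =>
      ∑ b ∈ S, monomial (b - sqfreeExp J) (g b J a)
    have hw : ∀ b, (fun J a => multidegPart b (fun J => w J a) J) = g b := by
      intro b
      ext J a
      rw [multidegPart]
      split_ifs with hle
      · rw [coeff_sum, sum_eq_single b]
        · simp
        · intro b' _ hb'
          by_cases hle' : sqfreeExp J ≤ b'
          · rw [coeff_monomial, if_neg]
            intro h
            exact hb' (by rw [← tsub_add_cancel_of_le hle', h, tsub_add_cancel_of_le hle])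
          · simp [hg b' J hle']
        · intro hb
          simp [hgS b hb]
      · rw [hg b J hle]
        rfl
    have hwt : ∀ k a, HasWeightLE k (N + 1) fun J => w J a := by
      intro k a J hJ c hc
      rw [coeff_eq_multidegPart c (fun J => w J a)] at hc
      change (fun J a => multidegPart (c + sqfreeExp J) (fun J => w J a) J) J a ≠ 0 at hc
      have h1 : multidegPart (c + sqfreeExp J) (fun J => w J a) J =
        g (c + sqfreeExp J) J a := congrFun (congrFun (hw (c + sqfreeExp J)) J) a
      have h2 : c + sqfreeExp J ∈ S := by
        by_contra h
        exact hc (h1.trans (by rw [hgS _ h]; rfl))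
      have h3 := (mem_filter.1 h2).2
      rw [map_add, tailDegree_sqfreeExp, hJ] at h3
      exact h3.le
    obtain ⟨w', hw'⟩ := ih (hcyc.sub_enD w) (by
      intro a ha J hJ c hc
      by_contra! hlt
      refine hc ?_
      have hb : N + 1 ≤ tailDegree (c + sqfreeExp J) := by
        rw [map_add, tailDegree_sqfreeExp, hJ]
        omega
      simp only [Pi.sub_apply, coeff_sub]
      rw [coeff_eq_multidegPart c (fun J => f J a), coeff_eq_multidegPart c
        (fun J => enD (linRow 1 0) (linRow lam mu) w J a),
        multidegPart_enD mu lam (hwt _ a) hb hJ, hw]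
      rcases hb.eq_or_lt with h | h
      · rw [hgN _ h.symm J hJ a ha, sub_self]
      · have h1 : c + sqfreeExp J ∉ S := fun h' => h.ne' (mem_filter.1 h').2
        rw [hgS _ h1, map_zero, ← coeff_eq_multidegPart c (fun J => f J a)]
        have h2 : coeff c (f J a) = 0 := by
          by_contra hne
          have := hN a ha J hJ c hne
          rw [map_add, tailDegree_sqfreeExp, hJ] at h
          omega
        simp [h2])
    refine ⟨w' + w, fun J hJ a ha => ?_⟩
    rw [map_add, Pi.add_apply, Pi.add_apply, hw' J hJ a ha]
    simp

end PolynomialENComplex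

section OrlikTeraoMinors

open Finset

variable {K : Type*} [Field K]

namespace CentralArrangement

/-- The `2 × 2` determinant of the forms `α_i`, `α_j`. -/
def det {ι : Type*} [Fintype ι] (A : CentralArrangement K ι 2) (i j : ι) : K :=
  A.form i 0 * A.form j 1 - A.form i 1 * A.form j 0

variable {ι : Type*} [Fintype ι] (A : CentralArrangement K ι 2)

lemma det_ne_zero {i j : ι} (hij : i ≠ j) : A.det i j ≠ 0 := by
  intro h
  unfold det at h
  by_cases h0 : A.form j 0 = 0
  · have h1 : A.form j 1 ≠ 0 := by
      intro h1
      refine A.nonzero j ?_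
      ext k
      fin_cases k <;> simp [h0, h1]
    refine A.nonProportional i j hij (A.form i 1 / A.form j 1) ?_
    ext k
    fin_cases k
    · simp only [h0, mul_zero, sub_zero, mul_eq_zero, h1, or_false] at h
      simp [h0, h]
    · simp [h1]
  · refine A.nonProportional i j hij (A.form i 0 / A.form j 0) ?_
    ext k
    fin_cases k
    · simp [h0]
    · simp only [Fin.mk_one, Pi.smul_apply, smul_eq_mul]
      field_simp
      linear_combination -h

lemma sum_mul_form {c : ι → K} (hc : c ∈ A.relSpace) (k : Fin 2) :
    ∑ i, c i * A.form i k = 0 := by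
  have h : (∑ i, c i • A.form i) = 0 := hc
  simpa using congrFun h k

lemma sum_mul_det {c : ι → K} (hc : c ∈ A.relSpace) (i : ι) : ∑ r, c r * A.det i r = 0 := by
  have h : ∀ r, c r * A.det i r =
      A.form i 0 * (c r * A.form r 1) - A.form i 1 * (c r * A.form r 0) := fun r => by
    unfold det
    ring
  simp only [h, sum_sub_distrib, ← mul_sum, A.sum_mul_form hc, mul_zero, sub_zero]

variable [DecidableEq ι]

/-- The generator `∂(c)` is a combination of the generators attached to the triples. -/
lemma otgen_mem {I : Ideal (MvPolynomial ι K)}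
    (hI : ∀ p q r, C (A.det p q) * (X p * X q) + C (A.det q r) * (X q * X r) +
      C (A.det r p) * (X r * X p) ∈ I)
    {c : ι → K} (hc : c ∈ A.relSpace) : otgen c ∈ I := by
  have hsupp : ∀ j, j ∈ vsupp c ↔ c j ≠ 0 := by
    intro j
    simp [vsupp]
  rcases (vsupp c).eq_empty_or_nonempty with he | ⟨p, hp⟩
  · simp [otgen, he]
  obtain ⟨q, hq, hqp⟩ : ∃ q ∈ vsupp c, q ≠ p := by
    by_contra! h
    refine A.nonzero p ?_
    ext k
    have h1 := A.sum_mul_form hc k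
    rw [sum_eq_single p] at h1
    · exact (mul_eq_zero.1 h1).resolve_left ((hsupp p).1 hp)
    · intro j _ hj
      rw [not_not.1 (mt (hsupp j).2 fun h' => hj (h j h')), zero_mul]
    · simp
  have hpq := A.det_ne_zero hqp.symm
  set Λ := vsupp c
  let P : ι → MvPolynomial ι K := fun j => ∏ l ∈ Λ.erase j, X l
  have hsum : ∀ i, ∑ r ∈ Λ, C (c r * A.det i r) = (0 : MvPolynomial ι K) := by
    intro i
    have h : ∑ r ∈ Λ, c r * A.det i r = 0 := by
      rw [← A.sum_mul_det hc i]
      refine sum_subset (subset_univ _) fun r _ hr => ?_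
      rw [not_not.1 (mt (hsupp r).2 hr), zero_mul]
    rw [← map_sum, h, map_zero]
  have hP : ∀ r ∈ Λ, C (A.det p q) * P r + C (A.det q r) * P p + C (A.det r p) * P q ∈ I := by
    intro r hr
    by_cases hrp : r = p
    · subst hrp
      convert I.zero_mem using 1
      have h1 : A.det q r = - A.det r q := by unfold det; ring
      have h2 : A.det r r = 0 := by unfold det; ring
      rw [h1, h2]
      simp
    by_cases hrq : r = q
    · subst hrq
      convert I.zero_mem using 1
      have h1 : A.det r p = - A.det p r := by unfold det; ring
      have h2 : A.det r r = 0 := by unfold det; ring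
      rw [h1, h2]
      simp
    have hPr : ∀ {x y z : ι}, x ∈ Λ → y ∈ Λ → z ∈ Λ → x ≠ y → x ≠ z → y ≠ z →
        P x = X y * X z * ∏ l ∈ ((Λ.erase x).erase y).erase z, X l := by
      intro x y z hx hy hz hxy hxz hyz
      simp only [P]
      rw [← mul_prod_erase (Λ.erase x) _ (mem_erase.2 ⟨hxy.symm, hy⟩),
        ← mul_prod_erase ((Λ.erase x).erase y) _
          (mem_erase.2 ⟨hyz.symm, mem_erase.2 ⟨hxz.symm, hz⟩⟩), mul_assoc]
    rw [hPr hr hp hq hrp hrq hqp.symm, hPr hp hq hr hqp.symm (Ne.symm hrp) (Ne.symm hrq),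
      hPr hq hr hp (Ne.symm hrq) hqp hrp]
    have e1 : ((Λ.erase p).erase q).erase r = ((Λ.erase r).erase p).erase q := by
      ext
      simp only [mem_erase]
      tauto
    have e2 : ((Λ.erase q).erase r).erase p = ((Λ.erase r).erase p).erase q := by
      ext
      simp only [mem_erase]
      tauto
    rw [e1, e2]
    convert I.mul_mem_left (∏ l ∈ ((Λ.erase r).erase p).erase q, X l) (hI p q r) using 1
    ring
  have key : C (A.det p q) * otgen c = ∑ r ∈ Λ, C (c r) *
      (C (A.det p q) * P r + C (A.det q r) * P p + C (A.det r p) * P q) := by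
    have h1 := hsum q
    have h2 := hsum p
    have h3 : ∀ r, C (c r) * (C (A.det p q) * P r + C (A.det q r) * P p + C (A.det r p) * P q) =
        C (A.det p q) * (C (c r) * P r) + C (c r * A.det q r) * P p -
          C (c r * A.det p r) * P q := by
      intro r
      have : A.det r p = -A.det p r := by unfold det; ring
      rw [this]
      simp only [map_mul, map_neg]
      ring
    simp only [h3, sum_sub_distrib, sum_add_distrib, ← sum_mul, h1, h2, zero_mul, add_zero,
      sub_zero, ← mul_sum]
    rfl
  have hmem : C (A.det p q) * otgen c ∈ I :=
    key ▸ I.sum_mem fun r hr => I.mul_mem_left _ (hP r hr)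
  have := I.mul_mem_left (C (A.det p q)⁻¹) hmem
  rwa [← mul_assoc, ← C_mul, inv_mul_cancel₀ hpq, C_1, one_mul] at this

/-- The generator of the Orlik–Terao ideal attached to a triple of hyperplanes. -/
lemma triple_mem_otIdeal {p q r : ι} (hpq : p ≠ q) (hqr : q ≠ r) (hrp : r ≠ p) :
    C (A.det p q) * (X p * X q) + C (A.det q r) * (X q * X r) + C (A.det r p) * (X r * X p) ∈
      A.otIdeal := by
  let c : ι → K := Pi.single p (A.det q r) + Pi.single q (A.det r p) + Pi.single r (A.det p q)
  have hcp : c p = A.det q r := by simp [c, hpq, hrp.symm]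
  have hcq : c q = A.det r p := by simp [c, hpq.symm, hqr]
  have hcr : c r = A.det p q := by simp [c, hqr.symm, hrp]
  have hc0 : ∀ j, j ≠ p → j ≠ q → j ≠ r → c j = 0 := by
    intro j h1 h2 h3
    simp [c, h1, h2, h3]
  have hc : c ∈ A.relSpace := by
    change ∑ i, c i • A.form i = 0
    simp only [c, Pi.add_apply, add_smul, sum_add_distrib, Pi.single_apply, ite_smul, zero_smul,
      sum_ite_eq', mem_univ, if_true]
    ext k
    fin_cases k <;> simp [det] <;> ring
  have hsupp : vsupp c = {p, q, r} := by
    ext j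
    simp only [vsupp, mem_filter, mem_univ, true_and, mem_insert, mem_singleton]
    constructor
    · contrapose!
      rintro ⟨h1, h2, h3⟩
      exact hc0 j h1 h2 h3
    · rintro (rfl | rfl | rfl)
      · exact hcp ▸ A.det_ne_zero hqr
      · exact hcq ▸ A.det_ne_zero hrp
      · exact hcr ▸ A.det_ne_zero hpq
  have e1 : ({p, q, r} : Finset ι).erase p = {q, r} := by
    ext j
    simp only [mem_erase, mem_insert, mem_singleton]
    grind
  have e2 : ({p, q, r} : Finset ι).erase q = {r, p} := by
    ext j
    simp only [mem_erase, mem_insert, mem_singleton]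
    grind
  have e3 : ({p, q, r} : Finset ι).erase r = {p, q} := by
    ext j
    simp only [mem_erase, mem_insert, mem_singleton]
    grind
  have hgen : otgen c = C (A.det p q) * (X p * X q) + C (A.det q r) * (X q * X r) +
      C (A.det r p) * (X r * X p) := by
    rw [otgen, hsupp, sum_insert (by simp [hpq, hrp.symm]), sum_insert (by simp [hqr]),
      sum_singleton, e1, e2, e3, prod_pair hqr, prod_pair hrp, prod_pair hpq, hcp, hcq, hcr]
    ring
  rw [← hgen]
  exact Ideal.subset_span ⟨c, hc, rfl⟩

end CentralArrangement

/-- In rank two the Orlik–Terao ideal is the ideal of maximal minors of a `2 × (d - 1)` matrix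
with rows `y_j` and `lam_j y_j + mu_j y_0`. -/
lemma CentralArrangement.exists_range_enAug_eq_otIdeal {m : ℕ}
    (A : CentralArrangement K (Fin (m + 1)) 2) :
    ∃ lam mu : Fin m → K, Function.Injective lam ∧
      LinearMap.range (enAug (linRow (1 : Fin m → K) 0) (linRow lam mu)) = A.otIdeal := by
  obtain ⟨b₀, b₁, hb⟩ : ∃ b₀ b₁ : K, b₀ * A.form 0 1 - b₁ * A.form 0 0 = -1 := by
    by_cases h0 : A.form 0 0 = 0
    · have h1 : A.form 0 1 ≠ 0 := by
        intro h1
        refine A.nonzero 0 ?_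
        ext k
        fin_cases k <;> simp [h0, h1]
      exact ⟨-(A.form 0 1)⁻¹, 0, by simp [h1]⟩
    · exact ⟨0, (A.form 0 0)⁻¹, by simp [h0]⟩
  have hne : ∀ j : Fin m, A.det 0 j.succ ≠ 0 := fun j => A.det_ne_zero (Fin.succ_ne_zero j).symm
  let lam : Fin m → K := fun j =>
    (b₀ * A.form j.succ 1 - b₁ * A.form j.succ 0) / A.det 0 j.succ
  let mu : Fin m → K := fun j => (A.det 0 j.succ)⁻¹
  have hlam : ∀ j k, A.det 0 j.succ * A.det 0 k.succ * (lam k - lam j) =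
      A.det j.succ k.succ := by
    intro j k
    have hj := hne j
    have hk := hne k
    simp only [lam]
    field_simp
    unfold CentralArrangement.det
    linear_combination (-(A.form j.succ 0 * A.form k.succ 1 -
      A.form j.succ 1 * A.form k.succ 0)) * hb
  have hminor : ∀ j k : Fin m, C (A.det 0 j.succ * A.det 0 k.succ) *
      (linRow 1 0 j * linRow lam mu k - linRow 1 0 k * linRow lam mu j) =
      C (A.det 0 j.succ) * (X 0 * X j.succ) +
        C (A.det j.succ k.succ) * (X j.succ * X k.succ) +
        C (A.det k.succ 0) * (X k.succ * X 0) := by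
    intro j k
    have h1 : A.det k.succ 0 = -A.det 0 k.succ := by
      unfold CentralArrangement.det
      ring
    have hj : (C (A.det 0 j.succ) * C (mu j) : MvPolynomial (Fin (m + 1)) K) = 1 := by
      rw [← C_mul, mul_inv_cancel₀ (hne j), C_1]
    have hk : (C (A.det 0 k.succ) * C (mu k) : MvPolynomial (Fin (m + 1)) K) = 1 := by
      rw [← C_mul, mul_inv_cancel₀ (hne k), C_1]
    rw [h1, ← hlam j k]
    simp only [linRow, Pi.one_apply, Pi.zero_apply, map_mul, map_sub, map_neg, map_one, map_zero]
    linear_combination (C (A.det 0 j.succ) * X 0 * X j.succ) * hk -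
      (C (A.det 0 k.succ) * X 0 * X k.succ) * hj
  refine ⟨lam, mu, fun j k hjk => ?_, le_antisymm ?_ ?_⟩
  · by_contra hne'
    refine A.det_ne_zero (fun h => hne' (Fin.succ_injective m h)) (i := j.succ) (j := k.succ) ?_
    rw [← hlam, hjk, sub_self, mul_zero]
  · rintro _ ⟨f, rfl⟩
    rw [enAug_apply, contract_contract_apply]
    refine Ideal.sum_mem _ fun p hp => Ideal.mul_mem_right _ _ (Ideal.mul_mem_left _ _ ?_)
    have hlt : p.1 < p.2 := (mem_filter.1 hp).2
    have h1 := A.triple_mem_otIdeal (Fin.succ_ne_zero p.2).symm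
      (fun h => hlt.ne' (Fin.succ_injective m h)) (Fin.succ_ne_zero p.1)
    rw [← hminor] at h1
    have h2 := A.otIdeal.mul_mem_left (C (A.det 0 p.2.succ * A.det 0 p.1.succ)⁻¹) h1
    rwa [← mul_assoc, ← C_mul, inv_mul_cancel₀ (mul_ne_zero (hne _) (hne _)), C_1, one_mul] at h2
  · have hlt : ∀ j k : Fin m, j < k →
        linRow 1 0 j * linRow lam mu k - linRow 1 0 k * linRow lam mu j ∈
          LinearMap.range (enAug (linRow (1 : Fin m → K) 0) (linRow lam mu)) := by
      intro j k hjk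
      refine ⟨fun J _ => if J = {j, k} then -1 else 0, ?_⟩
      rw [enAug_apply, contract_contract_apply, sum_eq_single (j, k)]
      · simp [insSign]
      · rintro ⟨x, y⟩ hxy hne
        have hxy' : x < y := (mem_filter.1 hxy).2
        rw [if_neg, mul_zero]
        intro h
        refine hne ?_
        have hx : x ∈ ({j, k} : Finset (Fin m)) := h ▸ by simp
        have hy : y ∈ ({j, k} : Finset (Fin m)) := h ▸ by simp
        simp only [mem_insert, mem_singleton] at hx hy
        rcases hx with rfl | rfl <;> rcases hy with rfl | rfl
        · exact absurd hxy' (lt_irrefl _)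
        · rfl
        · exact absurd hxy' hjk.not_gt
        · exact absurd hxy' (lt_irrefl _)
      · simp [hjk]
    set I : Ideal (MvPolynomial (Fin (m + 1)) K) :=
      LinearMap.range (enAug (linRow (1 : Fin m → K) 0) (linRow lam mu))
    have hmin : ∀ j k : Fin m,
        linRow 1 0 j * linRow lam mu k - linRow 1 0 k * linRow lam mu j ∈ I := by
      intro j k
      rcases lt_trichotomy j k with h | rfl | h
      · exact hlt j k h
      · rw [sub_self]
        exact I.zero_mem
      · rw [← neg_sub]
        exact I.neg_mem (hlt k j h)
    have hzero : ∀ j k : Fin (m + 1), C (A.det 0 j) * (X 0 * X j) + C (A.det j k) * (X j * X k) +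
        C (A.det k 0) * (X k * X 0) ∈ I := by
      intro j k
      have h0 : A.det 0 0 = 0 := by
        unfold CentralArrangement.det
        ring
      have hsw : ∀ i, A.det i 0 = -A.det 0 i := fun i => by
        unfold CentralArrangement.det
        ring
      induction j using Fin.cases with
      | zero =>
        convert I.zero_mem using 1
        rw [h0, hsw, map_neg]
        simp only [map_zero]
        ring
      | succ j =>
        induction k using Fin.cases with
        | zero =>
          convert I.zero_mem using 1
          rw [h0, hsw, map_neg]
          simp only [map_zero]
          ring
        | succ k =>
          rw [← hminor]
          exact I.mul_mem_left _ (hmin j k)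
    refine Ideal.span_le.2 ?_
    rintro _ ⟨c, hc, rfl⟩
    refine A.otgen_mem (fun p q r => ?_) hc
    convert I.add_mem (I.add_mem (hzero p q) (hzero q r)) (hzero r p) using 1
    have hsw : ∀ i, A.det i 0 = -A.det 0 i := fun i => by
      unfold CentralArrangement.det
      ring
    simp only [hsw, map_neg]
    ring

end OrlikTeraoMinors

section ENMatrix

open Finset

/-- The index set of the standard basis of the `i`-th module of the Eagon–Northcott complex. -/
def ENIndex (m : ℕ) : ℕ → Type
  | 0 => Unit
  | n + 1 => {J : Finset (Fin m) // #J = n + 2} × Fin (n + 1)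

instance (m : ℕ) : ∀ i, Fintype (ENIndex m i)
  | 0 => inferInstanceAs (Fintype Unit)
  | n + 1 => inferInstanceAs (Fintype ({J : Finset (Fin m) // #J = n + 2} × Fin (n + 1)))

lemma card_ENIndex_zero (m : ℕ) : Fintype.card (ENIndex m 0) = 1 := Fintype.card_unit

lemma card_ENIndex (m i : ℕ) (hi : 1 ≤ i) :
    Fintype.card (ENIndex m i) = i * m.choose (i + 1) := by
  obtain ⟨n, rfl⟩ := Nat.exists_eq_add_of_le' hi
  have h : Fintype.card ({J : Finset (Fin m) // #J = n + 2} × Fin (n + 1)) =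
      (n + 1) * m.choose (n + 2) := by
    rw [Fintype.card_prod, Fintype.card_finset_len, Fintype.card_fin, Fintype.card_fin, mul_comm]
  exact h

variable {m : ℕ} {A : Type*} [CommRing A]

/-- The standard basis vector `e_J ⊗ s^{(a)} t^{(n - a)}`. -/
def enBasis {n : ℕ} (r : ENIndex m (n + 1)) : Finset (Fin m) → ℕ → A :=
  Pi.single r.1.1 (Pi.single r.2.1 1)

/-- The matrices of the differentials of the Eagon–Northcott complex. -/
def enMatrix (u v : Fin m → A) : ∀ i, Matrix (ENIndex m (i + 1)) (ENIndex m i) A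
  | 0 => fun r _ => enAug u v (enBasis r)
  | _ + 1 => fun r c => enD u v (enBasis r) c.1.1 c.2.1

/-- The element of `Λ^{n+2} ⊗ D_n` with the given coordinates. -/
def enExtend {n : ℕ} (x : ENIndex m (n + 1) → A) : Finset (Fin m) → ℕ → A :=
  ∑ r, x r • enBasis r

lemma enExtend_apply {n : ℕ} (x : ENIndex m (n + 1) → A) (r : ENIndex m (n + 1)) :
    enExtend x r.1.1 r.2.1 = x r := by
  rw [enExtend, Finset.sum_apply, Finset.sum_apply, sum_eq_single r]
  · simp [enBasis]
  · intro r' _ hr'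
    by_cases h1 : r'.1.1 = r.1.1
    · have h2 : r'.2.1 ≠ r.2.1 := fun h2 => hr' (Prod.ext (Subtype.ext h1) (Fin.ext h2))
      simp [enBasis, h1, h2.symm]
    · simp [enBasis, Ne.symm h1]
  · simp

lemma vecMul_enMatrix_zero (u v : Fin m → A) (x : ENIndex m 1 → A) (c : ENIndex m 0) :
    Matrix.vecMul x (enMatrix u v 0) c = enAug u v (enExtend x) := by
  rw [enExtend, map_sum]
  simp only [map_smul]
  rfl

lemma vecMul_enMatrix_succ (u v : Fin m → A) {n : ℕ} (x : ENIndex m (n + 2) → A)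
    (c : ENIndex m (n + 1)) :
    Matrix.vecMul x (enMatrix u v (n + 1)) c = enD u v (enExtend x) c.1.1 c.2.1 := by
  rw [enExtend, map_sum, Finset.sum_apply, Finset.sum_apply]
  simp only [map_smul]
  rfl

lemma contract_congr (u : Fin m → A) {f g : Finset (Fin m) → A} {J : Finset (Fin m)}
    (h : ∀ I, #I = #J + 1 → f I = g I) : contract u f J = contract u g J := by
  rw [contract_apply, contract_apply]
  refine sum_congr rfl fun j hj => ?_
  rw [h _ (card_insert_of_notMem (mem_compl.1 hj))]

lemma enD_congr (u v : Fin m → A) {f g : Finset (Fin m) → ℕ → A} {J : Finset (Fin m)} {n a : ℕ}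
    (h : ∀ I, #I = #J + 1 → ∀ a ≤ n, f I a = g I a) (ha : a < n) :
    enD u v f J a = enD u v g J a := by
  rw [enD_apply, enD_apply, contract_congr u fun I hI => h I hI (a + 1) ha,
    contract_congr v fun I hI => h I hI a ha.le]

lemma enAug_congr (u v : Fin m → A) {f g : Finset (Fin m) → ℕ → A}
    (h : ∀ I, #I = 2 → f I 0 = g I 0) : enAug u v f = enAug u v g := by
  rw [enAug_apply, enAug_apply]
  exact contract_congr u fun I hI => contract_congr v fun I' hI' => h I' (by simp_all)

lemma enExtend_restrict {n : ℕ} (f : Finset (Fin m) → ℕ → A) :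
    ∀ J, #J = n + 2 → ∀ a ≤ n,
      enExtend (fun r : ENIndex m (n + 1) => f r.1.1 r.2.1) J a = f J a :=
  fun J hJ a ha => enExtend_apply (n := n) (fun r => f r.1.1 r.2.1)
    (⟨J, hJ⟩, ⟨a, Nat.lt_succ_of_le ha⟩)

lemma vecMul_enMatrix_eq_zero_iff (u v : Fin m → A) (n : ℕ) (x : ENIndex m (n + 1) → A) :
    Matrix.vecMul x (enMatrix u v n) = 0 ↔ IsENCycle u v n (enExtend x) := by
  cases n with
  | zero =>
    constructor
    · intro h
      refine ⟨fun _ => ?_, fun J _ a ha => absurd ha (Nat.not_lt_zero a)⟩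
      rw [← vecMul_enMatrix_zero u v x (), h]
      rfl
    · intro h
      ext c
      rw [vecMul_enMatrix_zero, h.1 rfl]
      rfl
  | succ n =>
    constructor
    · intro h
      refine ⟨fun h0 => absurd h0 (Nat.succ_ne_zero n), fun J hJ a ha => ?_⟩
      exact (vecMul_enMatrix_succ u v x (⟨J, hJ⟩, ⟨a, ha⟩)).symm.trans (by rw [h]; rfl)
    · intro h
      ext c
      rw [vecMul_enMatrix_succ, h.2 _ c.1.2 _ c.2.2]
      rfl

lemma IsENCycle.congr {u v : Fin m → A} {n : ℕ} {f g : Finset (Fin m) → ℕ → A}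
    (hf : IsENCycle u v n f) (h : ∀ J, #J = n + 2 → ∀ a ≤ n, f J a = g J a) :
    IsENCycle u v n g := by
  constructor
  · rintro rfl
    rw [← hf.1 rfl]
    exact enAug_congr u v fun I hI => (h I hI 0 le_rfl).symm
  · intro J hJ a ha
    rw [← hf.2 J hJ a ha]
    exact enD_congr u v (fun I hI a ha => (h I (by omega) a ha).symm) ha

lemma vecMul_enMatrix_enMatrix (u v : Fin m → A) (n : ℕ) (y : ENIndex m (n + 2) → A) :
    Matrix.vecMul (Matrix.vecMul y (enMatrix u v (n + 1))) (enMatrix u v n) = 0 := by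
  rw [vecMul_enMatrix_eq_zero_iff]
  have h : IsENCycle u v n (enD u v (enExtend y)) :=
    ⟨fun _ => enAug_enD u v _, fun J _ a _ => by rw [enD_enD]; rfl⟩
  refine h.congr fun J hJ a ha => ?_
  rw [← enExtend_restrict (enD u v (enExtend y)) J hJ a ha]
  congr 2
  ext c
  rw [vecMul_enMatrix_succ]

variable {K : Type*} [Field K]

lemma exists_vecMul_enMatrix_eq {mu lam : Fin m → K} (hlam : Function.Injective lam) {n : ℕ}
    {x : ENIndex m (n + 1) → MvPolynomial (Fin (m + 1)) K}
    (hx : Matrix.vecMul x (enMatrix (linRow 1 0) (linRow lam mu) n) = 0) :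
    ∃ y, Matrix.vecMul y (enMatrix (linRow 1 0) (linRow lam mu) (n + 1)) = x := by
  obtain ⟨w, hw⟩ := IsENCycle.exists_enD_eq hlam ((vecMul_enMatrix_eq_zero_iff _ _ n x).1 hx)
  refine ⟨fun r => w r.1.1 r.2.1, ?_⟩
  ext1 c
  have hc := c.1.2
  have hc' := c.2.2
  rw [vecMul_enMatrix_succ, enD_congr (n := n + 1) _ _
    (fun I hI a ha => enExtend_restrict w I (by omega) a ha) hc', hw _ hc _ (by omega),
    enExtend_apply]

lemma isHomogeneous_enBasis {n : ℕ} (r : ENIndex m (n + 1)) (J : Finset (Fin m)) (a : ℕ) :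
    (enBasis r J a : MvPolynomial (Fin (m + 1)) K).IsHomogeneous 0 := by
  unfold enBasis
  by_cases h : J = r.1.1
  · subst h
    rw [Pi.single_eq_same, Pi.single_apply]
    split_ifs
    · exact isHomogeneous_one _ _
    · exact isHomogeneous_zero _ _ _
  · rw [Pi.single_eq_of_ne h]
    exact isHomogeneous_zero _ _ _

lemma isHomogeneous_linRow (l mu : Fin m → K) (j : Fin m) : (linRow l mu j).IsHomogeneous 1 := by
  refine IsHomogeneous.add ?_ ?_
  · simpa using (isHomogeneous_C _ (l j)).mul (isHomogeneous_X K j.succ)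
  · simpa using (isHomogeneous_C _ (mu j)).mul (isHomogeneous_X K (0 : Fin (m + 1)))

lemma isHomogeneous_contract (l mu : Fin m → K) {k : ℕ}
    {f : Finset (Fin m) → MvPolynomial (Fin (m + 1)) K} (hf : ∀ J, (f J).IsHomogeneous k)
    (J : Finset (Fin m)) : (contract (linRow l mu) f J).IsHomogeneous (k + 1) := by
  rw [contract_apply]
  refine IsHomogeneous.sum _ _ _ fun j _ => ?_
  rw [C_insSign]
  have := (isHomogeneous_C (Fin (m + 1)) (insSign K j J)).mul
    ((isHomogeneous_linRow l mu j).mul (hf (insert j J)))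
  rw [zero_add] at this
  exact Nat.add_comm 1 k ▸ this

lemma isHomogeneous_enMatrix_zero (lam mu : Fin m → K) (r c) :
    (enMatrix (linRow 1 0) (linRow lam mu) 0 r c).IsHomogeneous 2 := by
  refine isHomogeneous_contract 1 0 (isHomogeneous_contract lam mu fun J => ?_) ∅
  exact isHomogeneous_enBasis r J 0

lemma isHomogeneous_enMatrix_succ (lam mu : Fin m → K) (n : ℕ) (r c) :
    (enMatrix (linRow 1 0) (linRow lam mu) (n + 1) r c).IsHomogeneous 1 :=
  (isHomogeneous_contract 1 0 (fun J => isHomogeneous_enBasis r J (c.2.1 + 1)) c.1.1).add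
    (isHomogeneous_contract lam mu (fun J => isHomogeneous_enBasis r J c.2.1) c.1.1)

end ENMatrix

section Reindex

open Finset

variable {K : Type*} [Field K] {ι : Type*} [Fintype ι] {I : Ideal (MvPolynomial ι K)}

/-- A minimal graded free resolution whose modules have bases indexed by arbitrary finite
types. -/
noncomputable def MinGradedFreeRes.ofFintype (len : ℕ) (E : ℕ → Type) [∀ i, Fintype (E i)]
    (deg : ℕ → ℕ) (M : ∀ i, Matrix (E (i + 1)) (E i) (MvPolynomial ι K))
    (card_zero : Fintype.card (E 0) = 1) (card_eq_zero : ∀ i, len < i → Fintype.card (E i) = 0)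
    (deg_zero : deg 0 = 0) (deg_lt : ∀ i, deg i < deg (i + 1))
    (homog : ∀ i r c, (M i r c).IsHomogeneous (deg (i + 1) - deg i))
    (exact : ∀ i x, (∃ y, Matrix.vecMul y (M (i + 1)) = x) ↔ Matrix.vecMul x (M i) = 0)
    (aug : ∀ x, (∃ y, Matrix.vecMul y (M 0) = x) ↔ ∀ c, x c ∈ I) :
    MinGradedFreeRes K ι I :=
  have key : ∀ i (y : Fin (Fintype.card (E (i + 1))) → MvPolynomial ι K),
      Matrix.vecMul y ((M i).submatrix (Fintype.equivFin (E (i + 1))).symm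
        (Fintype.equivFin (E i)).symm) =
      Matrix.vecMul (y ∘ Fintype.equivFin (E (i + 1))) (M i) ∘ (Fintype.equivFin (E i)).symm :=
    fun i y => by
      rw [Matrix.submatrix_vecMul_equiv]
      rfl
  { len := len
    rk := fun i => Fintype.card (E i)
    rk_zero := card_zero
    rk_eventually_zero := card_eq_zero
    deg := fun i _ => deg i
    deg_zero := fun _ => deg_zero
    mat := fun i => (M i).submatrix (Fintype.equivFin (E (i + 1))).symm
      (Fintype.equivFin (E i)).symm
    homog := fun i _ _ => homog i _ _
    minimal := fun i _ _ => by
      refine (homog i _ _).coeff_eq_zero ?_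
      have := deg_lt i
      rw [map_zero]
      omega
    exact := fun i => by
      ext x
      rw [LinearMap.mem_range, LinearMap.mem_ker]
      simp only [Matrix.vecMulLinear_apply, key]
      have hx : Matrix.vecMul (x ∘ Fintype.equivFin (E (i + 1))) (M i) ∘
          (Fintype.equivFin (E i)).symm = 0 ↔
          Matrix.vecMul (x ∘ Fintype.equivFin (E (i + 1))) (M i) = 0 := by
        rw [Equiv.comp_symm_eq]
        rfl
      rw [hx, ← exact]
      constructor
      · rintro ⟨y, rfl⟩
        exact ⟨y ∘ Fintype.equivFin (E (i + 2)), by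
          rw [Function.comp_assoc, Equiv.symm_comp_self, Function.comp_id]⟩
      · rintro ⟨y, hy⟩
        refine ⟨y ∘ (Fintype.equivFin (E (i + 2))).symm, ?_⟩
        rw [Function.comp_assoc, Equiv.symm_comp_self, Function.comp_id, hy,
          Function.comp_assoc, Equiv.self_comp_symm, Function.comp_id]
    aug := by
      ext x
      rw [LinearMap.mem_range, Submodule.mem_pi]
      simp only [Matrix.vecMulLinear_apply, key, Set.mem_univ, forall_true_left]
      have hx : (∀ c, x c ∈ I) ↔ ∀ c, (x ∘ Fintype.equivFin (E 0)) c ∈ I :=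
        ⟨fun h c => h _, fun h c => by simpa using h ((Fintype.equivFin (E 0)).symm c)⟩
      rw [hx, ← aug]
      constructor
      · rintro ⟨y, rfl⟩
        exact ⟨y ∘ Fintype.equivFin (E 1), by
          rw [Function.comp_assoc, Equiv.symm_comp_self, Function.comp_id]⟩
      · rintro ⟨y, hy⟩
        refine ⟨y ∘ (Fintype.equivFin (E 1)).symm, ?_⟩
        rw [Function.comp_assoc, Equiv.symm_comp_self, Function.comp_id, hy,
          Function.comp_assoc, Equiv.self_comp_symm, Function.comp_id] }

end Reindex

/-- Let `A` be an essential central arrangement of rank 2 consisting of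
`d ≥ 4` hyperplanes (`d` distinct points in `P^1`) with Orlik-Terao ideal
`I ⊆ R = K[y_1,…,y_d]`.  Then `R/I` has an Eagon-Northcott (minimal graded free) resolution
whose only nonzero graded Betti numbers in homological degrees `i ≥ 1` occur in internal
degree `i + 1`, with `dim_K Tor_i^R(R/I,K)_{i+1} = i · C(d−1, i+1)` for `1 ≤ i ≤ d − 2`. -/
theorem rank_two_otIdeal_eagonNorthcott
    (K : Type*) [Field K] (d : ℕ) (hd : 4 ≤ d)
    (A : CentralArrangement K (Fin d) 2) :
    ∃ res : MinGradedFreeRes K (Fin d) A.otIdeal,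
      res.len = d - 2 ∧
      ∀ i, 1 ≤ i → i ≤ d - 2 →
        res.rk i = i * (d - 1).choose (i + 1) ∧ ∀ r, res.deg i r = i + 1 := by
  obtain ⟨m, rfl⟩ : ∃ m, d = m + 1 := ⟨d - 1, by omega⟩
  obtain ⟨lam, mu, hlam, hI⟩ := A.exists_range_enAug_eq_otIdeal
  refine ⟨MinGradedFreeRes.ofFintype (m + 1 - 2) (ENIndex m) (fun i => if i = 0 then 0 else i + 1)
    (enMatrix (linRow 1 0) (linRow lam mu)) (card_ENIndex_zero m) ?_ (by simp) ?_ ?_ ?_ ?_, rfl,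
    fun i hi _ => ⟨card_ENIndex m i hi, fun _ => if_neg (by omega)⟩⟩
  · intro i hi
    rw [card_ENIndex m i (by omega), Nat.choose_eq_zero_of_lt (show m < i + 1 by omega), mul_zero]
  · intro i
    rw [if_neg i.succ_ne_zero]
    split_ifs <;> omega
  · intro i r c
    cases i with
    | zero => exact isHomogeneous_enMatrix_zero lam mu r c
    | succ n =>
      convert isHomogeneous_enMatrix_succ lam mu n r c using 1
      simp
  · intro i x
    refine ⟨?_, exists_vecMul_enMatrix_eq hlam⟩
    rintro ⟨y, rfl⟩
    exact vecMul_enMatrix_enMatrix _ _ i y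
  · intro x
    rw [← hI]
    constructor
    · rintro ⟨y, rfl⟩ c
      exact ⟨enExtend y, (vecMul_enMatrix_zero _ _ y c).symm⟩
    · intro h
      obtain ⟨f, hf⟩ := h ()
      refine ⟨fun r => f r.1.1 r.2.1, ?_⟩
      ext1 c
      rw [vecMul_enMatrix_zero, enAug_congr _ _ fun I hI => enExtend_restrict f I hI 0 le_rfl, hf]
      rfl
end
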